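/- arXiv:0904.4814 — 2 statements merged into one kernel-verified Lean document; each statement's English description precedes it below -/
import Mathlib

section
/- Let S be a board whose number of black cells equals its number of white cells, say both equal to n, and fix bijections β : Fin n ≃ {black cells of S} and ω : Fin n ≃ {white cells of S}. Then the determinant of the black-to-white matrix B of S (with respect to β and ω) is equal to 0, 1 or −1. -/
open scoped Matrix

/-- A cell of the integer grid, representing the closed unit square
`[p₁, p₁+1] × [p₂, p₂+1] ⊆ ℝ²`. -/
abbrev Cell : Type := ℤ × ℤ

/-- The closed unit square in `ℝ²` corresponding to a cell. -/
def unitSquare (p : Cell) : Set (ℝ × ℝ) :=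
  (Set.Icc (p.1 : ℝ) ((p.1 : ℝ) + 1)) ×ˢ (Set.Icc (p.2 : ℝ) ((p.2 : ℝ) + 1))

/-- The region of the plane covered by a finite set of cells. -/
def Region (S : Finset Cell) : Set (ℝ × ℝ) := ⋃ p ∈ S, unitSquare p

/-- A board: a finite nonempty set of cells whose region is homeomorphic to the
closed unit disk in `ℝ²`. -/
def IsBoard (S : Finset Cell) : Prop :=
  S.Nonempty ∧
    Nonempty ((Region S) ≃ₜ (Metric.closedBall (0 : EuclideanSpace ℝ (Fin 2)) 1))

/-- A cell is black if the sum of its coordinates is even. -/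
def IsBlackCell (p : Cell) : Prop := Even (p.1 + p.2)

instance (p : Cell) : Decidable (IsBlackCell p) := by
  unfold IsBlackCell; infer_instance

/-- The black cells of `S`. -/
def blackCells (S : Finset Cell) : Finset Cell := S.filter IsBlackCell

/-- The white cells of `S`. -/
def whiteCells (S : Finset Cell) : Finset Cell := S.filter fun p => ¬ IsBlackCell p

/-- Two cells are adjacent when they share an edge. -/
def Adjacent (p q : Cell) : Prop :=
  p - q = (1, 0) ∨ p - q = (-1, 0) ∨ p - q = (0, 1) ∨ p - q = (0, -1)

instance (p q : Cell) : Decidable (Adjacent p q) := by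
  unfold Adjacent; infer_instance

/-- The black-to-white adjacency matrix of a set of cells, with respect to
labelings `β` of the black cells and `ω` of the white cells. -/
def btwMatrix {S : Finset Cell} {b w : ℕ}
    (β : Fin b ≃ blackCells S) (ω : Fin w ≃ whiteCells S) :
    Matrix (Fin b) (Fin w) ℤ :=
  fun i j => if Adjacent (β i : Cell) (ω j : Cell) then 1 else 0

/-! ### Topological part -/

namespace DT

noncomputable section

/-- The complex coordinate of a point, relative to the centre of the cell `u`. -/
def zeta (u : Cell) (p : ℝ × ℝ) : ℂ :=
  ⟨p.1 - u.1 - 1 / 2, p.2 - u.2 - 1 / 2⟩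

lemma continuous_zeta (u : Cell) : Continuous (zeta u) := by
  have : zeta u = fun p : ℝ × ℝ =>
      ((p.1 - u.1 - 1 / 2 : ℝ) : ℂ) + ((p.2 - u.2 - 1 / 2 : ℝ) : ℂ) * Complex.I := by
    funext p
    apply Complex.ext <;> simp [zeta]
  rw [this]
  fun_prop

/-- The corner (south-west) of a cell as a real point. -/
def pt (c : Cell) : ℝ × ℝ := ((c.1 : ℝ), (c.2 : ℝ))

lemma int_ne_half (a b : ℤ) : (a : ℝ) - b - 1 / 2 ≠ 0 := by
  intro h
  have h2 : ((2 * a - 2 * b : ℤ) : ℝ) = ((1 : ℤ) : ℝ) := by push_cast; linarith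
  have h3 : (2 * a - 2 * b : ℤ) = 1 := by exact_mod_cast h2
  omega

lemma edge_log (w d : ℂ) (hw : w ≠ 0)
    (hs : ∀ t : unitInterval, (w + (t : ℝ) * d) / w ∈ Complex.slitPlane)
    (F : C(unitInterval, ℂ)) (hF : ∀ t : unitInterval, Complex.exp (F t) = w + (t : ℝ) * d) :
    F 1 - F 0 = Complex.log ((w + d) / w) := by
  have hc : Continuous (fun t : unitInterval => Complex.log ((w + (t : ℝ) * d) / w) + F 0) := by
    refine Continuous.add (Continuous.clog ?_ hs) continuous_const
    fun_prop
  have h0 : Complex.exp (F 0) = w := by simpa using hF 0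
  have key := Complex.isCoveringMap_exp.eq_of_comp_eq (A := unitInterval) F.continuous hc
    (by
      funext t
      apply Subtype.ext
      simp only [Function.comp]
      rw [Complex.exp_add, Complex.exp_log (Complex.slitPlane_ne_zero (hs t)), h0, hF t]
      field_simp) 0 (by simp [hw])
  have := congrFun key 1
  simp only [this]
  simp

lemma slit_h (w : ℂ) (hw : w.im ≠ 0) (t : ℝ) : (w + t * 1) / w ∈ Complex.slitPlane := by
  have hw0 : w ≠ 0 := fun h => hw (by simp [h])
  have e : (w + t * 1) / w = 1 + t * w⁻¹ := by field_simp
  rw [e, Complex.mem_slitPlane_iff]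
  by_cases ht : t = 0
  · left; simp [ht]
  · right
    simp [Complex.inv_im, ht, hw, hw0]

lemma slit_v (w : ℂ) (hw : w.re ≠ 0) (t : ℝ) : (w + t * Complex.I) / w ∈ Complex.slitPlane := by
  have hw0 : w ≠ 0 := fun h => hw (by simp [h])
  have e : (w + t * Complex.I) / w = 1 + t * (Complex.I * w⁻¹) := by field_simp
  rw [e, Complex.mem_slitPlane_iff]
  by_cases ht : t = 0
  · left; simp [ht]
  · right
    simp [Complex.inv_re, ht, hw, hw0]

/-- increment of the logarithm along a horizontal side. -/
def thH (u c : Cell) : ℂ := Complex.log ((zeta u (pt c) + 1) / zeta u (pt c))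

/-- increment of the logarithm along a vertical side. -/
def thV (u c : Cell) : ℂ := Complex.log ((zeta u (pt c) + Complex.I) / zeta u (pt c))

lemma edge_h (u c : Cell) (K : Set (ℝ × ℝ)) (f : ℝ × ℝ → ℂ) (hf : ContinuousOn f K)
    (he : ∀ p ∈ K, Complex.exp (f p) = zeta u p)
    (hK : ∀ t ∈ Set.Icc (0 : ℝ) 1, ((c.1 : ℝ) + t, (c.2 : ℝ)) ∈ K) :
    f (pt (c + (1, 0))) - f (pt c) = thH u c := by
  have him : (zeta u (pt c)).im ≠ 0 := int_ne_half _ _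
  have hw0 : zeta u (pt c) ≠ 0 := fun h => him (by simp [h])
  have hc : Continuous (fun t : unitInterval => f ((c.1 : ℝ) + t, (c.2 : ℝ))) :=
    hf.comp_continuous (by fun_prop) (fun t => hK t t.2)
  have := edge_log (zeta u (pt c)) 1 hw0 (fun t => slit_h _ him t) ⟨_, hc⟩ (by
    intro t
    simp only [ContinuousMap.coe_mk]
    rw [he _ (hK t t.2)]
    apply Complex.ext <;> simp [zeta, pt]
    ring)
  simpa [thH, pt] using this

lemma edge_v (u c : Cell) (K : Set (ℝ × ℝ)) (f : ℝ × ℝ → ℂ) (hf : ContinuousOn f K)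
    (he : ∀ p ∈ K, Complex.exp (f p) = zeta u p)
    (hK : ∀ t ∈ Set.Icc (0 : ℝ) 1, ((c.1 : ℝ), (c.2 : ℝ) + t) ∈ K) :
    f (pt (c + (0, 1))) - f (pt c) = thV u c := by
  have him : (zeta u (pt c)).re ≠ 0 := int_ne_half _ _
  have hw0 : zeta u (pt c) ≠ 0 := fun h => him (by simp [h])
  have hc : Continuous (fun t : unitInterval => f ((c.1 : ℝ), (c.2 : ℝ) + t)) :=
    hf.comp_continuous (by fun_prop) (fun t => hK t t.2)
  have := edge_log (zeta u (pt c)) Complex.I hw0 (fun t => slit_v _ him t) ⟨_, hc⟩ (by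
    intro t
    simp only [ContinuousMap.coe_mk]
    rw [he _ (hK t t.2)]
    apply Complex.ext <;> simp [zeta, pt]
    ring)
  simpa [thV, pt] using this

/-- The four sides of a unit square contained in `K`. -/
lemma sides (u c : Cell) (K : Set (ℝ × ℝ)) (f : ℝ × ℝ → ℂ) (hf : ContinuousOn f K)
    (he : ∀ p ∈ K, Complex.exp (f p) = zeta u p) (hK : unitSquare c ⊆ K) :
    (f (pt (c + (1, 0))) - f (pt c) = thH u c ∧
    f (pt (c + (0, 1) + (1, 0))) - f (pt (c + (0, 1))) = thH u (c + (0, 1))) ∧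
    f (pt (c + (0, 1))) - f (pt c) = thV u c ∧
    f (pt (c + (1, 0) + (0, 1))) - f (pt (c + (1, 0))) = thV u (c + (1, 0)) := by
  refine ⟨⟨edge_h u _ K f hf he ?_, edge_h u _ K f hf he ?_⟩,
    edge_v u _ K f hf he ?_, edge_v u _ K f hf he ?_⟩ <;>
  · intro t ht
    apply hK
    obtain ⟨h1, h2⟩ := ht
    simp [unitSquare, h1, h2]

/-- total increment around a cell -/
def dth (u c : Cell) : ℂ := thH u c - thH u (c + (0, 1)) - (thV u c - thV u (c + (1, 0)))

lemma dth_self (u : Cell) : dth u u = 2 * Real.pi * Complex.I := by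
  have e1 : (zeta u (pt u) + 1) / zeta u (pt u) = Complex.I := by
    have h : zeta u (pt u) = -(1 + Complex.I) / 2 := by
      apply Complex.ext <;> simp [zeta, pt] <;> norm_num
    have h0 : zeta u (pt u) ≠ 0 := fun h => int_ne_half u.1 u.1 (by
      have := congrArg Complex.re h
      simp [zeta, pt] at this)
    rw [div_eq_iff h0, h]
    linear_combination (1 / 2 : ℂ) * Complex.I_sq
  have e2 : (zeta u (pt (u + (0, 1))) + 1) / zeta u (pt (u + (0, 1))) = - Complex.I := by
    have h : zeta u (pt (u + (0, 1))) = (-1 + Complex.I) / 2 := by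
      apply Complex.ext <;> simp [zeta, pt] <;> ring
    have h0 : zeta u (pt (u + (0, 1))) ≠ 0 := fun h => int_ne_half u.1 u.1 (by
      have := congrArg Complex.re h
      simp [zeta, pt] at this)
    rw [div_eq_iff h0, h]
    linear_combination (1 / 2 : ℂ) * Complex.I_sq
  have e3 : (zeta u (pt u) + Complex.I) / zeta u (pt u) = -Complex.I := by
    have h : zeta u (pt u) = -(1 + Complex.I) / 2 := by
      apply Complex.ext <;> simp [zeta, pt] <;> norm_num
    have h0 : zeta u (pt u) ≠ 0 := fun h => int_ne_half u.1 u.1 (by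
      have := congrArg Complex.re h
      simp [zeta, pt] at this)
    rw [div_eq_iff h0, h]
    linear_combination (-1 / 2 : ℂ) * Complex.I_sq
  have e4 : (zeta u (pt (u + (1, 0))) + Complex.I) / zeta u (pt (u + (1, 0))) = Complex.I := by
    have h : zeta u (pt (u + (1, 0))) = (1 - Complex.I) / 2 := by
      apply Complex.ext <;> simp [zeta, pt] <;> ring
    have h0 : zeta u (pt (u + (1, 0))) ≠ 0 := fun h => int_ne_half u.2 u.2 (by
      have := congrArg Complex.im h
      simp [zeta, pt] at this)
    rw [div_eq_iff h0, h]
    linear_combination (1 / 2 : ℂ) * Complex.I_sq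
  rw [dth, thH, thH, thV, thV, e1, e2, e3, e4, Complex.log_I, Complex.log_neg_I]
  ring

lemma dth_of_sides (u c : Cell) (f : ℝ × ℝ → ℂ) 
    (h : (f (pt (c + (1, 0))) - f (pt c) = thH u c ∧
    f (pt (c + (0, 1) + (1, 0))) - f (pt (c + (0, 1))) = thH u (c + (0, 1))) ∧
    f (pt (c + (0, 1))) - f (pt c) = thV u c ∧
    f (pt (c + (1, 0) + (0, 1))) - f (pt (c + (1, 0))) = thV u (c + (1, 0))) :
    dth u c = 0 := by
  obtain ⟨⟨h1, h2⟩, h3, h4⟩ := h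
  rw [dth, ← h1, ← h2, ← h3, ← h4, add_right_comm c (0, 1) (1, 0)]
  ring

lemma half_plane (m n : ℤ) (h : m ≠ 0 ∨ n ≠ 0) (s t : ℝ) (hs : |s| ≤ 1 / 2) (ht : |t| ≤ 1 / 2) :
    0 < (m + s) * m + (n + t) * n := by
  have aux : ∀ (k : ℤ) (r : ℝ), |r| ≤ 1 / 2 → (k : ℝ) ^ 2 / 2 ≤ (k + r) * k := by
    intro k r hr
    have h1 : |(k : ℝ)| ≤ (k : ℝ) ^ 2 := by
      have : |k| ≤ k ^ 2 := by
        rw [← sq_abs]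
        nlinarith [abs_nonneg k, sq_nonneg (|k| - 1), Int.le_self_sq |k|]
      exact_mod_cast this
    have h2 : |r * k| ≤ (k : ℝ) ^ 2 / 2 := by
      rw [abs_mul]
      nlinarith [abs_nonneg (k : ℝ), abs_nonneg r]
    have := neg_abs_le (r * k)
    nlinarith
  have h1 := aux m s hs
  have h2 := aux n t ht
  have h3 : (0 : ℝ) < (m : ℝ) ^ 2 + (n : ℝ) ^ 2 := by
    rcases h with h | h
    · have : (m : ℝ) ≠ 0 := by exact_mod_cast h
      positivity
    · have : (n : ℝ) ≠ 0 := by exact_mod_cast h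
      positivity
  linarith

lemma dth_other (u c : Cell) (h : c ≠ u) : dth u c = 0 := by
  set m : ℂ := ⟨((c.1 - u.1 : ℤ) : ℝ), ((c.2 - u.2 : ℤ) : ℝ)⟩ with hm
  have hne : c.1 - u.1 ≠ 0 ∨ c.2 - u.2 ≠ 0 := by
    by_contra! hc
    exact h (Prod.ext (by omega) (by omega))
  have hslit : ∀ p ∈ unitSquare c, zeta u p / m ∈ Complex.slitPlane ∧ m ≠ 0 := by
    intro p hp
    simp only [unitSquare, Set.mem_prod, Set.mem_Icc] at hp
    obtain ⟨⟨h1, h2⟩, h3, h4⟩ := hp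
    have hpos := half_plane _ _ hne (p.1 - c.1 - 1 / 2) (p.2 - c.2 - 1 / 2)
      (abs_le.2 ⟨by linarith, by linarith⟩) (abs_le.2 ⟨by linarith, by linarith⟩)
    have hm0 : m ≠ 0 := by
      intro h0
      have e1 := congrArg Complex.re h0
      have e2 := congrArg Complex.im h0
      simp only [hm, Complex.zero_re, Complex.zero_im, Int.cast_eq_zero] at e1 e2
      omega
    refine ⟨?_, hm0⟩
    rw [Complex.mem_slitPlane_iff]
    left
    rw [Complex.div_re, ← add_div]
    apply div_pos _ (Complex.normSq_pos.2 hm0)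
    simp only [zeta, hm]
    push_cast at hpos ⊢
    linarith
  apply dth_of_sides u c (fun p => Complex.log (zeta u p / m) + Complex.log m)
  refine sides u c (unitSquare c) (fun p => Complex.log (zeta u p / m) + Complex.log m) ?_ ?_ subset_rfl
  · refine ContinuousOn.add (ContinuousOn.clog ?_ fun p hp => (hslit p hp).1) continuousOn_const
    exact ((continuous_zeta u).div_const m).continuousOn
  · intro p hp
    obtain ⟨h1, h2⟩ := hslit p hp
    rw [Complex.exp_add, Complex.exp_log (Complex.slitPlane_ne_zero h1), Complex.exp_log h2]
    field_simp

lemma exists_log (S : Finset Cell) (hS : IsBoard S) (u : Cell) (hu : u ∉ S) :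
    ∃ f : ℝ × ℝ → ℂ, ContinuousOn f (Region S) ∧
      ∀ p ∈ Region S, Complex.exp (f p) = zeta u p := by
  obtain ⟨-, ⟨e⟩⟩ := hS
  have hz : ∀ p ∈ Region S, zeta u p ≠ 0 := by
    intro p hp h0
    have e1 := congrArg Complex.re h0
    have e2 := congrArg Complex.im h0
    simp only [zeta, Complex.zero_re, Complex.zero_im] at e1 e2
    simp only [Region, Set.mem_iUnion, unitSquare, Set.mem_prod, Set.mem_Icc] at hp
    obtain ⟨q, hq, ⟨h1, h2⟩, h3, h4⟩ := hp
    apply hu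
    have k1 : (q.1 : ℝ) < u.1 + 1 := by linarith
    have k2 : (u.1 : ℝ) < q.1 + 1 := by linarith
    have k3 : (q.2 : ℝ) < u.2 + 1 := by linarith
    have k4 : (u.2 : ℝ) < q.2 + 1 := by linarith
    norm_cast at k1 k2 k3 k4
    have : u = q := Prod.ext (by omega) (by omega)
    rwa [this]
  have hconv : Convex ℝ (Metric.closedBall (0 : EuclideanSpace ℝ (Fin 2)) 1) := convex_closedBall _ _
  have : ContractibleSpace (Metric.closedBall (0 : EuclideanSpace ℝ (Fin 2)) 1) :=
    hconv.contractibleSpace ⟨0, by simp⟩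
  have : LocallyPathConnectedSpace (Metric.closedBall (0 : EuclideanSpace ℝ (Fin 2)) 1) :=
    hconv.locallyPathConnectedSpace
  let g : C(Metric.closedBall (0 : EuclideanSpace ℝ (Fin 2)) 1, ℂ) :=
    ⟨fun x => zeta u (e.symm x), (continuous_zeta u).comp
      (continuous_subtype_val.comp e.symm.continuous)⟩
  have hg : ∀ x, g x ∈ ({0}ᶜ : Set ℂ) := fun x => hz _ (e.symm x).2
  let a₀ : Metric.closedBall (0 : EuclideanSpace ℝ (Fin 2)) 1 := ⟨0, by simp⟩
  obtain ⟨F, ⟨-, hF⟩, -⟩ := Complex.isCoveringMapOn_exp.existsUnique_continuousMap_lifts g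
    (a₀ := a₀) (e₀ := Complex.log (g a₀)) (Complex.exp_log (hg a₀)) hg
  classical
  refine ⟨fun p => if h : p ∈ Region S then F (e ⟨p, h⟩) else 0, ?_, ?_⟩
  · rw [continuousOn_iff_continuous_domRestrict]
    have : (Region S).domRestrict (fun p => if h : p ∈ Region S then F (e ⟨p, h⟩) else 0)
        = fun p => F (e p) := by
      funext p
      simp [Set.domRestrict]
    rw [this]
    exact F.continuous.comp e.continuous
  · intro p hp
    have := congrFun hF (e ⟨p, hp⟩)
    simp only [Function.comp] at this
    simp only [hp, dif_pos]
    rw [this]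
    simp [g]

lemma sum_shift (U : Finset Cell) (d : Cell) (H : Cell → ℂ)
    (h1 : ∀ c ∈ U, c - d ∉ U → H c = 0) (h2 : ∀ c ∈ U, c + d ∉ U → H (c + d) = 0) :
    ∑ c ∈ U, (H c - H (c + d)) = 0 := by
  rw [Finset.sum_sub_distrib, sub_eq_zero]
  have e1 : ∑ c ∈ U, H c = ∑ c ∈ U with c - d ∈ U, H c := by
    rw [Finset.sum_filter]
    refine Finset.sum_congr rfl fun c hc => ?_
    split_ifs with h
    · rfl
    · exact h1 c hc h
  have e2 : ∑ c ∈ U, H (c + d) = ∑ c ∈ U with c + d ∈ U, H (c + d) := by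
    rw [Finset.sum_filter]
    refine Finset.sum_congr rfl fun c hc => ?_
    split_ifs with h
    · rfl
    · exact h2 c hc h
  rw [e1, e2]
  refine Finset.sum_bij' (fun c _ => c - d) (fun c _ => c + d) ?_ ?_ ?_ ?_ ?_ <;>
    simp +contextual

/-- The complement of a board is edge-connected: no finite nonempty set of
cells outside the board is separated from the rest of the outside. -/
theorem no_hole (S : Finset Cell) (hS : IsBoard S) (U : Finset Cell) (hne : U.Nonempty)
    (hU : ∀ c ∈ U, c ∉ S) :
    ∃ c ∈ U, ∃ d, Adjacent c d ∧ d ∉ S ∧ d ∉ U := by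
  by_contra! hcon
  obtain ⟨u, hu⟩ := hne
  obtain ⟨f, hf, he⟩ := exists_log S hS u (hU u hu)
  have hsub : ∀ c ∈ S, unitSquare c ⊆ Region S := fun c hc => Set.subset_biUnion_of_mem hc
  have hside := fun c hc => sides u c (Region S) f hf he (hsub c hc)
  have hadj : ∀ c ∈ U, ∀ d, Adjacent c d → d ∉ U → d ∈ S := by
    intro c hc d hd hdU
    by_contra hdS
    exact hdU (hcon c hc d hd hdS)
  let H : Cell → ℂ := fun c => thH u c - (f (pt (c + (1, 0))) - f (pt c))
  let V : Cell → ℂ := fun c => thV u c - (f (pt (c + (0, 1))) - f (pt c))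
  have hH : ∑ c ∈ U, (H c - H (c + (0, 1))) = 0 := by
    apply sum_shift
    · intro c hc h
      have h' := hside _ (hadj c hc _ (by simp [Adjacent]) h)
      have := h'.1.2
      simp only [sub_add_cancel] at this
      simp [H, this]
    · intro c hc h
      have h' := hside _ (hadj c hc _ (by simp [Adjacent]) h)
      have := h'.1.1
      simp only [H, this, sub_self]
  have hV : ∑ c ∈ U, (V c - V (c + (1, 0))) = 0 := by
    apply sum_shift
    · intro c hc h
      have h' := hside _ (hadj c hc _ (by simp [Adjacent]) h)
      have := h'.2.2
      simp only [sub_add_cancel] at this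
      simp [V, this]
    · intro c hc h
      have h' := hside _ (hadj c hc _ (by simp [Adjacent]) h)
      have := h'.2.1
      simp only [V, this, sub_self]
  have hd : ∀ c, dth u c = (H c - H (c + (0, 1))) - (V c - V (c + (1, 0))) := by
    intro c
    simp only [H, V, dth, add_right_comm c (0, 1) (1, 0)]
    ring
  have hsum : ∑ c ∈ U, dth u c = 0 := by
    simp_rw [hd]
    rw [Finset.sum_sub_distrib, hH, hV, sub_zero]
  rw [Finset.sum_eq_single u (fun c _ hc => dth_other u c hc) (fun h => absurd hu h),
    dth_self] at hsum
  simp [Real.pi_ne_zero] at hsum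

end

end DT


/-! ### Flows on finite directed graphs -/

namespace DT

lemma contract_sum {ι N R : Type*} [DecidableEq N] [AddCommGroup R] (E : Finset ι)
    (r : ι → N) (x : ι → R) (s0 t0 n : N) (hst : s0 ≠ t0) :
    (∑ e ∈ E, if (if r e = t0 then s0 else r e) = n then x e else 0) =
      (if n = t0 then 0 else ∑ e ∈ E, if r e = n then x e else 0) +
      (if n = s0 then ∑ e ∈ E, if r e = t0 then x e else 0 else 0) := by
  by_cases h1 : n = t0
  · subst h1
    simp only [if_true, hst.symm, if_false, add_zero]
    refine Finset.sum_eq_zero fun e _ => ?_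
    split_ifs <;> simp_all
  · by_cases h2 : n = s0
    · subst h2
      simp only [h1, if_true, if_false]
      rw [← Finset.sum_add_distrib]
      refine Finset.sum_congr rfl fun e _ => ?_
      by_cases h3 : r e = t0
      · simp [h3, hst.symm]
      · simp [h3]
    · simp only [h1, h2, if_false, add_zero]
      refine Finset.sum_congr rfl fun e _ => ?_
      by_cases h3 : r e = t0
      · simp [h3, Ne.symm h2, Ne.symm h1]
      · simp [h3]

/-- A nonzero flow with values in any abelian group forces a nonzero integral flow. -/
theorem flow_lift {ι N R : Type*} [DecidableEq ι] [DecidableEq N] [AddCommGroup R]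
    (a : ι → R) (E : Finset ι) :
    ∀ s t : ι → N, (∀ e ∈ E, a e ≠ 0) → E.Nonempty →
      (∀ n, (∑ e ∈ E, if s e = n then a e else 0) = ∑ e ∈ E, if t e = n then a e else 0) →
      ∃ b : ι → ℤ, (∀ e, e ∉ E → b e = 0) ∧ (∃ e, b e ≠ 0) ∧
        ∀ n, (∑ e ∈ E, if s e = n then b e else 0) = ∑ e ∈ E, if t e = n then b e else 0 := by
  induction E using Finset.induction_on with
  | empty => intro s t _ h; simp at h
  | insert e0 E he ih =>
    intro s t ha _ hc
    by_cases hst : s e0 = t e0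
    · refine ⟨fun e => if e = e0 then 1 else 0, ?_, ⟨e0, by simp⟩, ?_⟩
      · intro e h
        have : e ≠ e0 := fun h' => h (by simp [h'])
        simp [this]
      · intro n
        rw [Finset.sum_insert he, Finset.sum_insert he, hst]
        congr 1
        refine Finset.sum_congr rfl fun e h => ?_
        have : e ≠ e0 := fun h' => he (h' ▸ h)
        simp [this]
    · simp_rw [Finset.sum_insert he] at hc
      have hs0 := hc (s e0)
      have ht0 := hc (t e0)
      simp only [if_true, hst, Ne.symm hst, if_false, zero_add] at hs0 ht0
      have hne : E.Nonempty := by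
        by_contra hE
        rw [Finset.not_nonempty_iff_eq_empty] at hE
        subst hE
        simp only [Finset.sum_empty, add_zero] at ht0
        exact ha e0 (by simp) ht0.symm
      obtain ⟨b, hb1, ⟨e1, he1⟩, hb2⟩ := ih
        (fun e => if s e = t e0 then s e0 else s e) (fun e => if t e = t e0 then s e0 else t e)
        (fun e h => ha e (Finset.mem_insert_of_mem h)) hne (by
          intro n
          rw [contract_sum E s a _ _ _ hst, contract_sum E t a _ _ _ hst]
          by_cases h2 : n = s e0
          · subst h2
            simp only [hst, if_true, if_false]
            rw [ht0, ← hs0]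
            abel
          · by_cases h1 : n = t e0
            · simp [h1, Ne.symm hst]
            · have := hc n
              simp only [Ne.symm h1, Ne.symm h2, if_false, zero_add] at this
              simp [h1, h2, this])
      set x : ℤ := (∑ e ∈ E, if s e = t e0 then b e else 0) -
        ∑ e ∈ E, if t e = t e0 then b e else 0 with hx
      have hne0 : ∀ e ∈ E, e ≠ e0 := fun e h h' => he (h' ▸ h)
      have hsum : ∀ (r : ι → N) n, (∑ e ∈ E, if r e = n then (if e = e0 then x else b e) else 0)
          = ∑ e ∈ E, if r e = n then b e else 0 := by
        intro r n
        refine Finset.sum_congr rfl fun e h => ?_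
        simp [hne0 e h]
      refine ⟨fun e => if e = e0 then x else b e, ?_, ⟨e1, ?_⟩, ?_⟩
      · intro e h
        rw [Finset.mem_insert, not_or] at h
        simp [h.1, hb1 e h.2]
      · have : e1 ≠ e0 := fun h' => he1 (hb1 e1 (h' ▸ he))
        simpa [this] using he1
      · intro n
        rw [Finset.sum_insert he, Finset.sum_insert he, hsum, hsum]
        have hn := hb2 n
        rw [contract_sum E s b _ _ _ hst, contract_sum E t b _ _ _ hst] at hn
        by_cases h2 : n = s e0
        · subst h2
          simp only [hst, Ne.symm hst, if_true, if_false] at hn ⊢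
          linarith
        · by_cases h1 : n = t e0
          · subst h1
            simp only [hst, if_true, if_false]
            linarith
          · simp only [h1, h2, Ne.symm h1, Ne.symm h2, if_false, add_zero] at hn ⊢
            linarith

/-! ### From integral flows to integral kernel vectors -/

/-- Local integrality conditions for a flow on the auxiliary graph of `S`. The six values at a
cell are the flows on its north, east, south, west sides (clockwise) and the two diagonals. -/
structure IsFlow (S : Finset Cell) (p : Cell → Fin 6 → ℤ) : Prop where
  black : ∀ b, ¬ IsBlackCell b → ∀ k, p b k = 0
  inS : ∀ b ∈ S, p b 0 = 0 ∧ p b 1 = 0 ∧ p b 2 = 0 ∧ p b 3 = 0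
  outS : ∀ b, b ∉ S → p b 4 = 0 ∧ p b 5 = 0
  north : ∀ b, b ∉ S → b + (0, 1) ∉ S → p b 0 = 0
  east : ∀ b, b ∉ S → b + (1, 0) ∉ S → p b 1 = 0
  south : ∀ b, b ∉ S → b + (0, -1) ∉ S → p b 2 = 0
  west : ∀ b, b ∉ S → b + (-1, 0) ∉ S → p b 3 = 0
  cons : ∀ v : Cell, p (v - (0, 1)) 0 + p (v - (1, 1)) 1 + p (v - (1, 0)) 2 + p v 3 + p v 4
      + p (v - (0, 1)) 5 = p (v - (1, 1)) 0 + p (v - (1, 0)) 1 + p v 2 + p (v - (0, 1)) 3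
      + p (v - (1, 1)) 4 + p (v - (1, 0)) 5

lemma not_black_add (b d : Cell) (hb : IsBlackCell b) (hd : ¬ Even (d.1 + d.2)) :
    ¬ IsBlackCell (b + d) := by
  simp only [IsBlackCell, Prod.fst_add, Prod.snd_add] at *
  intro h
  apply hd
  have := h.sub hb
  ring_nf at this ⊢
  exact this

/-- A one-form on the white lattice which is closed around all black cells is exact. -/
lemma exists_potential (a : Cell → ℤ) (M : ℕ)
    (ha : ∀ v : Cell, a v ≠ 0 → -(M : ℤ) < v.1 ∧ v.1 < M ∧ -(M : ℤ) < v.2 ∧ v.2 < M)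
    (hcl : ∀ b : Cell, IsBlackCell b →
      a (b + (0, 1)) + a b = a (b + (1, 1)) + a (b + (1, 0))) :
    ∃ g : Cell → ℤ, (∀ w, g w - g (w - (1, 1)) = a w) ∧
      (∀ v, IsBlackCell v → g (v - (1, 0)) - g (v - (0, 1)) = a v) ∧
      (∀ w, ¬ IsBlackCell w → g w ≠ 0 →
        -(M : ℤ) ≤ w.1 ∧ w.1 ≤ M ∧ -(M : ℤ) ≤ w.2 ∧ w.2 ≤ M) := by
  have ha' : ∀ v : Cell, v.1 ≤ -(M : ℤ) ∨ (M : ℤ) ≤ v.1 ∨ v.2 ≤ -(M : ℤ) ∨ (M : ℤ) ≤ v.2 →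
      a v = 0 := by
    intro v hv
    by_contra h
    have := ha v h
    omega
  let g : Cell → ℤ := fun w => ∑ k ∈ Finset.range (w.1 + M).toNat, a (w - ((k : ℤ), (k : ℤ)))
  have g_low : ∀ w : Cell, w.1 ≤ -(M : ℤ) → g w = 0 := by
    intro w hw
    have : (w.1 + M).toNat = 0 := by omega
    simp [g, this]
  have g_low2 : ∀ w : Cell, w.2 ≤ -(M : ℤ) → g w = 0 := by
    intro w hw
    refine Finset.sum_eq_zero fun k _ => ha' _ ?_
    right; right; left
    simp only [Prod.snd_sub]
    omega
  have g_step : ∀ w, g w - g (w - (1, 1)) = a w := by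
    intro w
    by_cases hw : w.1 ≤ -(M : ℤ)
    · rw [g_low w hw, g_low _ (by simp only [Prod.fst_sub]; omega), ha' w (by left; exact hw)]
      simp
    · have e : (w.1 + M).toNat = ((w - (1, 1) : Cell).1 + (M : ℤ)).toNat + 1 := by
        simp only [Prod.fst_sub]
        omega
      simp only [g]
      rw [e, Finset.sum_range_succ']
      have : ∀ k : ℕ, w - (((k + 1 : ℕ) : ℤ), ((k + 1 : ℕ) : ℤ)) = w - (1, 1) - ((k : ℤ), (k : ℤ)) := by
        intro k
        ext <;> simp <;> ring
      simp_rw [this]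
      have h0 : w - (((0 : ℕ) : ℤ), ((0 : ℕ) : ℤ)) = w := by ext <;> simp
      rw [h0]
      ring
  have g_diag : ∀ n : ℕ, ∀ v : Cell, v.1 ≤ -(M : ℤ) + n → IsBlackCell v →
      g (v - (1, 0)) - g (v - (0, 1)) = a v := by
    intro n
    induction n with
    | zero =>
      intro v hv _
      rw [g_low _ (by simp only [Prod.fst_sub]; omega), g_low _ (by simp only [Prod.fst_sub]; omega),
        ha' v (by omega)]
      simp
    | succ n ih =>
      intro v hv hb
      have hb' : IsBlackCell (v - (1, 1)) := by
        simp only [IsBlackCell, Prod.fst_sub, Prod.snd_sub] at *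
        have := hb.sub (even_two (α := ℤ))
        ring_nf at this ⊢
        exact this
      have h1 := ih (v - (1, 1)) (by simp only [Prod.fst_sub]; push_cast at hv; omega) hb'
      have h2 := hcl _ hb'
      have e1 : v - (1, 1) + (0, 1) = v - (1, 0) := by ext <;> simp
      have e2 : v - (1, 1) + (1, 1) = v := by ext <;> simp
      have e3 : v - (1, 1) + (1, 0) = v - (0, 1) := by ext <;> simp
      rw [e1, e2, e3] at h2
      have h3 := g_step (v - (1, 0))
      have h4 := g_step (v - (0, 1))
      have e4 : v - (1, 0) - (1, 1) = v - (1, 1) - (1, 0) := sub_right_comm _ _ _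
      have e5 : v - (0, 1) - (1, 1) = v - (1, 1) - (0, 1) := sub_right_comm _ _ _
      rw [e4] at h3
      rw [e5] at h4
      linarith
  have g_diag' : ∀ v, IsBlackCell v → g (v - (1, 0)) - g (v - (0, 1)) = a v := fun v hv =>
    g_diag (v.1 + M).toNat v (by omega) hv
  have bl : ∀ (w d : Cell), ¬ IsBlackCell w → ¬ Even (d.1 + d.2) → IsBlackCell (w + d) := by
    intro w d hw hd
    simp only [IsBlackCell, Prod.fst_add, Prod.snd_add] at *
    rw [Int.not_even_iff_odd] at *
    have := hw.add_odd hd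
    ring_nf at this ⊢
    exact this
  have hi1 : ∀ n : ℕ, ∀ w : Cell, ¬ IsBlackCell w → (M : ℤ) ≤ w.2 → w.1 ≤ -(M : ℤ) + n → g w = 0 := by
    intro n
    induction n with
    | zero => intro w _ _ h; exact g_low w (by simpa using h)
    | succ n ih =>
      intro w hw h1 h2
      have h3 := g_diag' (w + (0, 1)) (bl _ _ hw (by decide))
      have e1 : w + (0, 1) - (1, 0) = w + (-1, 1) := by ext <;> simp; ring
      have e2 : w + (0, 1) - (0, 1) = w := by simp
      rw [e1, e2, ha' _ (by simp only [Prod.snd_add]; omega),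
        ih (w + (-1, 1)) ?_ (by simp only [Prod.snd_add]; omega)
          (by simp only [Prod.fst_add]; push_cast at h2; omega)] at h3
      · omega
      · intro h
        apply hw
        simp only [IsBlackCell, Prod.fst_add, Prod.snd_add] at *
        ring_nf at h ⊢
        exact h
  have hi2 : ∀ n : ℕ, ∀ w : Cell, ¬ IsBlackCell w → (M : ℤ) ≤ w.1 → w.2 ≤ -(M : ℤ) + n → g w = 0 := by
    intro n
    induction n with
    | zero => intro w _ _ h; exact g_low2 w (by simpa using h)
    | succ n ih =>
      intro w hw h1 h2
      have h3 := g_diag' (w + (1, 0)) (bl _ _ hw (by decide))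
      have e1 : w + (1, 0) - (0, 1) = w + (1, -1) := by ext <;> simp; ring
      have e2 : w + (1, 0) - (1, 0) = w := by simp
      rw [e1, e2, ha' _ (by simp only [Prod.fst_add]; omega),
        ih (w + (1, -1)) ?_ (by simp only [Prod.fst_add]; omega)
          (by simp only [Prod.snd_add]; push_cast at h2; omega)] at h3
      · omega
      · intro h
        apply hw
        simp only [IsBlackCell, Prod.fst_add, Prod.snd_add] at *
        ring_nf at h ⊢
        exact h
  refine ⟨g, g_step, g_diag', ?_⟩
  intro w hw hg
  by_contra hcon
  apply hg
  by_cases c1 : w.1 ≤ -(M : ℤ)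
  · exact g_low w c1
  by_cases c2 : w.2 ≤ -(M : ℤ)
  · exact g_low2 w c2
  by_cases c3 : (M : ℤ) ≤ w.2
  · exact hi1 (w.1 + M).toNat w hw c3 (by omega)
  · exact hi2 (w.2 + M).toNat w hw (by omega) (by omega)

/-- A nonzero integral flow gives a nonzero integral kernel vector. -/
theorem kernel_of_flow (S : Finset Cell)
    (hole : ∀ U : Finset Cell, U.Nonempty → (∀ c ∈ U, c ∉ S) →
      ∃ c ∈ U, ∃ d, Adjacent c d ∧ d ∉ S ∧ d ∉ U)
    (p : Cell → Fin 6 → ℤ) (hp : IsFlow S p) (M : ℕ)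
    (hM : ∀ b k, p b k ≠ 0 → -(M : ℤ) < b.1 ∧ b.1 < M ∧ -(M : ℤ) < b.2 ∧ b.2 < M)
    (hne : ∃ b k, p b k ≠ 0) :
    ∃ g : Cell → ℤ, (∃ c, g c ≠ 0) ∧ (∀ c, g c ≠ 0 → c ∈ whiteCells S) ∧
      ∀ b ∈ blackCells S, g (b + (0, 1)) + g (b + (0, -1)) = g (b + (1, 0)) + g (b + (-1, 0)) := by
  classical
  let a : Cell → ℤ := fun v => p (v - (1, 1)) 0 - p (v - (1, 1)) 1 + p (v - (1, 1)) 4 +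
    (p (v - (1, 0)) 1 - p (v - (1, 0)) 2 + p (v - (1, 0)) 5)
  have a2 : ∀ v, a v = p v 3 - p v 2 + p v 4 +
      (p (v - (0, 1)) 0 - p (v - (0, 1)) 3 + p (v - (0, 1)) 5) := by
    intro v
    have := hp.cons v
    simp only [a]
    linarith
  have aNE : ∀ b, IsBlackCell b → a (b + (1, 1)) = p b 0 - p b 1 + p b 4 := by
    intro b hb
    have h := hp.black (b + (0, 1)) (not_black_add b _ hb (by decide))
    have e1 : b + (1, 1) - (1, 1) = b := by simp
    have e2 : b + (1, 1) - (1, 0) = b + (0, 1) := by ext <;> simp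
    simp only [a, e1, e2, h]
    ring
  have aSE : ∀ b, IsBlackCell b → a (b + (1, 0)) = p b 1 - p b 2 + p b 5 := by
    intro b hb
    have h := hp.black (b + (0, -1)) (not_black_add b _ hb (by decide))
    have e1 : b + (1, 0) - (1, 1) = b + (0, -1) := by ext <;> simp; ring
    have e2 : b + (1, 0) - (1, 0) = b := by simp
    simp only [a, e1, e2, h]
    ring
  have aSW : ∀ b, IsBlackCell b → a b = p b 3 - p b 2 + p b 4 := by
    intro b hb
    have h := hp.black (b + (0, -1)) (not_black_add b _ hb (by decide))
    have e1 : b - (0, 1) = b + (0, -1) := by ext <;> simp; ring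
    rw [a2, e1, h, h, h]
    ring
  have aNW : ∀ b, IsBlackCell b → a (b + (0, 1)) = p b 0 - p b 3 + p b 5 := by
    intro b hb
    have h := hp.black (b + (0, 1)) (not_black_add b _ hb (by decide))
    have e1 : b + (0, 1) - (0, 1) = b := by simp
    rw [a2, e1, h, h, h]
    ring
  obtain ⟨g, g1, g2, g3⟩ := exists_potential a (M + 1) (by
    intro v hv
    have : p (v - (1, 1)) 0 ≠ 0 ∨ p (v - (1, 1)) 1 ≠ 0 ∨ p (v - (1, 1)) 4 ≠ 0 ∨
        p (v - (1, 0)) 1 ≠ 0 ∨ p (v - (1, 0)) 2 ≠ 0 ∨ p (v - (1, 0)) 5 ≠ 0 := by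
      by_contra! hc
      apply hv
      simp only [a, hc]
      simp
    rcases this with h | h | h | h | h | h <;>
    · have := hM _ _ h
      simp only [Prod.fst_sub, Prod.snd_sub] at this
      push_cast
      omega) (by
    intro b hb
    rw [aNE b hb, aSE b hb, aSW b hb, aNW b hb]
    ring)
  -- relations around a black cell
  have rNE : ∀ b, IsBlackCell b → g (b + (0, 1)) - g (b + (1, 0)) = p b 0 - p b 1 + p b 4 := by
    intro b hb
    rw [← aNE b hb, ← g2 (b + (1, 1)) (by
      simp only [IsBlackCell, Prod.fst_add, Prod.snd_add] at *
      have := hb.add (even_two (α := ℤ))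
      ring_nf at this ⊢
      exact this)]
    congr 2 <;> ext <;> simp
  have rSW : ∀ b, IsBlackCell b → g (b + (-1, 0)) - g (b + (0, -1)) = p b 3 - p b 2 + p b 4 := by
    intro b hb
    rw [← aSW b hb, ← g2 b hb]
    congr 2
  have rSE : ∀ b, IsBlackCell b → g (b + (1, 0)) - g (b + (0, -1)) = p b 1 - p b 2 + p b 5 := by
    intro b hb
    rw [← aSE b hb, ← g1]
    congr 2; ext <;> simp; ring
  have rNW : ∀ b, IsBlackCell b → g (b + (0, 1)) - g (b + (-1, 0)) = p b 0 - p b 3 + p b 5 := by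
    intro b hb
    rw [← aNW b hb, ← g1]
    congr 2; ext <;> simp; ring
  let val : Cell → ℤ := fun c => if IsBlackCell c then g (c + (0, 1)) - p c 0 else g c
  have val_adj : ∀ b w, IsBlackCell b → b ∉ S → w ∉ S → Adjacent b w →
      ¬ IsBlackCell w ∧ val w = val b := by
    intro b w hb hbS hwS hadj
    obtain ⟨h4, h5⟩ := hp.outS b hbS
    have n1 := rNE b hb
    have n2 := rSE b hb
    have n3 := rNW b hb
    have hw : w = b + (0, 1) ∨ w = b + (1, 0) ∨ w = b + (0, -1) ∨ w = b + (-1, 0) := by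
      simp only [Adjacent, Prod.ext_iff, Prod.fst_sub, Prod.snd_sub, Prod.fst_add,
        Prod.snd_add] at hadj ⊢
      omega
    rcases hw with rfl | rfl | rfl | rfl
    · have hnb := not_black_add b (0, 1) hb (by decide)
      have := hp.north b hbS hwS
      refine ⟨hnb, ?_⟩
      simp only [val, hb, hnb, if_true, if_false]
      linarith
    · have hnb := not_black_add b (1, 0) hb (by decide)
      have := hp.east b hbS hwS
      refine ⟨hnb, ?_⟩
      simp only [val, hb, hnb, if_true, if_false]
      linarith
    · have hnb := not_black_add b (0, -1) hb (by decide)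
      have := hp.south b hbS hwS
      refine ⟨hnb, ?_⟩
      simp only [val, hb, hnb, if_true, if_false]
      linarith
    · have hnb := not_black_add b (-1, 0) hb (by decide)
      have := hp.west b hbS hwS
      refine ⟨hnb, ?_⟩
      simp only [val, hb, hnb, if_true, if_false]
      linarith
  have val_zero : ∀ c, c ∉ S → val c = 0 := by
    let box : Finset Cell := Finset.Icc (-(M : ℤ) - 3) (M + 3) ×ˢ Finset.Icc (-(M : ℤ) - 3) (M + 3)
    have val_box : ∀ c, val c ≠ 0 → c ∈ box := by
      intro c hc
      simp only [box, Finset.mem_product, Finset.mem_Icc]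
      by_cases hb : IsBlackCell c
      · simp only [val, hb, if_true] at hc
        by_cases h0 : p c 0 = 0
        · have := g3 (c + (0, 1)) (not_black_add c _ hb (by decide)) (by
            intro h; apply hc; rw [h, h0]; simp)
          simp only [Prod.fst_add, Prod.snd_add] at this
          push_cast at this
          omega
        · have := hM _ _ h0
          omega
      · simp only [val, hb, if_false] at hc
        have := g3 c hb hc
        push_cast at this
        omega
    by_contra! hcon
    obtain ⟨c0, hc0, hv0⟩ := hcon
    obtain ⟨c, hc, d, hcd, hdS, hdU⟩ := hole (box.filter fun c => c ∉ S ∧ val c ≠ 0)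
      ⟨c0, by simp [val_box c0 hv0, hc0, hv0]⟩ (by intro c hc; simp at hc; exact hc.2.1)
    simp only [Finset.mem_filter] at hc hdU
    have hval : val d = val c := by
      by_cases hb : IsBlackCell c
      · exact (val_adj c d hb hc.2.1 hdS hcd).2
      · have hd : IsBlackCell d := by
          simp only [Adjacent, IsBlackCell, Prod.ext_iff, Prod.fst_sub, Prod.snd_sub,
            Int.even_iff] at hcd hb ⊢
          omega
        have hdc : Adjacent d c := by
          simp only [Adjacent, Prod.ext_iff, Prod.fst_sub, Prod.snd_sub] at hcd ⊢
          omega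
        exact (val_adj d c hd hdS hc.2.1 hdc).2.symm
    have hd0 : val d ≠ 0 := hval ▸ hc.2.2
    exact hdU ⟨val_box d hd0, hdS, hd0⟩
  refine ⟨fun c => if IsBlackCell c then 0 else g c, ?_, ?_, ?_⟩
  · by_contra! hcon
    obtain ⟨b, k, hbk⟩ := hne
    have hb : IsBlackCell b := by
      by_contra hb
      exact hbk (hp.black b hb k)
    have hg : ∀ d : Cell, ¬ Even (d.1 + d.2) → g (b + d) = 0 := by
      intro d hd
      simpa [not_black_add b d hb hd] using hcon (b + d)
    have n1 := rNE b hb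
    have n2 := rSE b hb
    have n3 := rNW b hb
    have n4 := rSW b hb
    rw [hg _ (by decide), hg _ (by decide)] at n1 n2 n3 n4
    apply hbk
    by_cases hbS : b ∈ S
    · obtain ⟨h0, h1, h2, h3⟩ := hp.inS b hbS
      fin_cases k <;> simp <;> linarith
    · obtain ⟨h4, h5⟩ := hp.outS b hbS
      have hv := val_zero b hbS
      simp only [val, hb, if_true] at hv
      rw [hg _ (by decide)] at hv
      fin_cases k <;> simp <;> linarith
  · intro c hc
    by_cases hb : IsBlackCell c
    · simp [hb] at hc
    · simp only [hb, if_false] at hc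
      simp only [whiteCells, Finset.mem_filter, hb, not_false_eq_true, and_true]
      by_contra hcS
      have := val_zero c hcS
      simp only [val, hb, if_false] at this
      exact hc this
  · intro b hb
    simp only [blackCells, Finset.mem_filter] at hb
    obtain ⟨hbS, hb⟩ := hb
    obtain ⟨h0, h1, h2, h3⟩ := hp.inS b hbS
    have n1 := rNE b hb
    have n4 := rSW b hb
    simp only [not_black_add b (0, 1) hb (by decide), not_black_add b (0, -1) hb (by decide),
      not_black_add b (1, 0) hb (by decide), not_black_add b (-1, 0) hb (by decide), if_false]
    linarith

end DT

/-! ### Transporting kernel vectors through flows -/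

namespace DT

/-- Source offsets of the six kinds of edges. -/
def srcOff : Fin 6 → Cell := ![(0, 1), (1, 1), (1, 0), (0, 0), (0, 0), (0, 1)]

/-- Target offsets of the six kinds of edges. -/
def tgtOff : Fin 6 → Cell := ![(1, 1), (1, 0), (0, 0), (0, 1), (1, 1), (1, 0)]

lemma sum_off {R : Type*} [AddCommGroup R] (E : Finset (Cell × Fin 6)) (x : Cell × Fin 6 → R)
    (hx : ∀ e, e ∉ E → x e = 0) (o : Fin 6 → Cell) (v : Cell) :
    (∑ e ∈ E, if e.1 + o e.2 = v then x e else 0) = ∑ k : Fin 6, x (v - o k, k) := by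
  classical
  have h1 : (∑ e ∈ E, if e.1 + o e.2 = v then x e else 0) =
      ∑ e ∈ E, ∑ k : Fin 6, if e = (v - o k, k) then x e else 0 := by
    refine Finset.sum_congr rfl fun e _ => ?_
    rw [Finset.sum_eq_single e.2]
    · congr 1
      rw [← eq_sub_iff_add_eq]
      conv_rhs => rw [Prod.ext_iff (x := e)]
      simp only [and_true]
    · intro k _ hk
      rw [if_neg]
      intro h
      apply hk
      rw [h]
    · simp
  rw [h1, Finset.sum_comm]
  refine Finset.sum_congr rfl fun k _ => ?_
  rw [Finset.sum_ite_eq' E (v - o k, k) x]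
  split_ifs with h
  · rfl
  · exact (hx _ h).symm

/-- The flow on the auxiliary graph attached to a function on cells. -/
def flowOf {R : Type*} [Ring R] (S : Finset Cell) (g : Cell → R) (b : Cell) (k : Fin 6) : R :=
  if IsBlackCell b then
    (if b ∈ S then
      ![0, 0, 0, 0, g (b + (0, 1)) - g (b + (1, 0)), g (b + (0, 1)) - g (b + (-1, 0))] k
    else ![g (b + (0, 1)), g (b + (1, 0)), g (b + (0, -1)), g (b + (-1, 0)), 0, 0] k)
  else 0

theorem lift_kernel {R : Type*} [Ring R] (S : Finset Cell)
    (hole : ∀ U : Finset Cell, U.Nonempty → (∀ c ∈ U, c ∉ S) →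
      ∃ c ∈ U, ∃ d, Adjacent c d ∧ d ∉ S ∧ d ∉ U)
    (g : Cell → R) (hne : ∃ c, g c ≠ 0) (hw : ∀ c, g c ≠ 0 → c ∈ whiteCells S)
    (hk : ∀ b ∈ blackCells S,
      g (b + (0, 1)) + g (b + (0, -1)) = g (b + (1, 0)) + g (b + (-1, 0))) :
    ∃ g : Cell → ℤ, (∃ c, g c ≠ 0) ∧ (∀ c, g c ≠ 0 → c ∈ whiteCells S) ∧
      ∀ b ∈ blackCells S, g (b + (0, 1)) + g (b + (0, -1)) = g (b + (1, 0)) + g (b + (-1, 0)) := by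
  classical
  have hS : ∀ c, c ∉ S → g c = 0 := by
    intro c hc
    by_contra h
    exact hc (Finset.mem_filter.1 (hw c h)).1
  have hk' : ∀ b ∈ S, IsBlackCell b →
      g (b + (0, 1)) + g (b + (0, -1)) = g (b + (1, 0)) + g (b + (-1, 0)) :=
    fun b h1 h2 => hk b (Finset.mem_filter.2 ⟨h1, h2⟩)
  set F := flowOf S g with hF
  have Fw : ∀ b, ¬ IsBlackCell b → ∀ k, F b k = 0 := by
    intro b hb k
    simp [hF, flowOf, hb]
  -- finite support
  obtain ⟨M, hM⟩ : ∃ M : ℕ, ∀ c ∈ S, -(M : ℤ) < c.1 ∧ c.1 < M ∧ -(M : ℤ) < c.2 ∧ c.2 < M := by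
    refine ⟨(∑ c ∈ S, (c.1.natAbs + c.2.natAbs)) + 1, fun c hc => ?_⟩
    have := Finset.single_le_sum (f := fun c : Cell => c.1.natAbs + c.2.natAbs)
      (fun _ _ => Nat.zero_le _) hc
    omega
  have Fsupp : ∀ b k, F b k ≠ 0 →
      -((M + 1 : ℕ) : ℤ) < b.1 ∧ b.1 < (M + 1 : ℕ) ∧ -((M + 1 : ℕ) : ℤ) < b.2 ∧
        b.2 < (M + 1 : ℕ) := by
    intro b k hbk
    by_contra hcon
    apply hbk
    push_cast at hcon
    have hb : b ∉ S := fun h => by have := hM b h; omega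
    have hN : g (b + (0, 1)) = 0 := hS _ fun h => by
      have := hM _ h; simp only [Prod.fst_add, Prod.snd_add] at this; omega
    have hE : g (b + (1, 0)) = 0 := hS _ fun h => by
      have := hM _ h; simp only [Prod.fst_add, Prod.snd_add] at this; omega
    have hSo : g (b + (0, -1)) = 0 := hS _ fun h => by
      have := hM _ h; simp only [Prod.fst_add, Prod.snd_add] at this; omega
    have hW : g (b + (-1, 0)) = 0 := hS _ fun h => by
      have := hM _ h; simp only [Prod.fst_add, Prod.snd_add] at this; omega
    simp only [hF, flowOf, hb, if_false, hN, hE, hSo, hW]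
    split_ifs
    · fin_cases k <;> rfl
    · rfl
  let box : Finset (Cell × Fin 6) :=
    (Finset.Icc (-(M : ℤ) - 1) (M + 1) ×ˢ Finset.Icc (-(M : ℤ) - 1) (M + 1)) ×ˢ Finset.univ
  let φ : Cell × Fin 6 → R := fun e => F e.1 e.2
  let E : Finset (Cell × Fin 6) := box.filter fun e => φ e ≠ 0
  have hE : ∀ e, e ∉ E → φ e = 0 := by
    intro e he
    by_contra h
    apply he
    have := Fsupp _ _ h
    push_cast at this
    simp only [E, box, Finset.mem_filter, Finset.mem_product, Finset.mem_Icc, Finset.mem_univ]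
    refine ⟨⟨⟨⟨?_, ?_⟩, ⟨?_, ?_⟩⟩, trivial⟩, h⟩ <;> omega
  have hE' : ∀ e ∈ E, φ e ≠ 0 := fun e he => (Finset.mem_filter.1 he).2
  have hEne : E.Nonempty := by
    obtain ⟨c0, hc0⟩ := hne
    obtain ⟨w, hwm, hmax⟩ := Finset.exists_max_image (S.filter fun c => g c ≠ 0) (fun c => c.2)
      ⟨c0, by simp [hc0, (Finset.mem_filter.1 (hw c0 hc0)).1]⟩
    have hgw := (Finset.mem_filter.1 hwm).2
    have hwb := (Finset.mem_filter.1 (hw w hgw)).2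
    have hb : IsBlackCell (w + (0, 1)) := by
      simp only [IsBlackCell, Int.even_iff, Prod.fst_add, Prod.snd_add] at hwb ⊢
      omega
    have eS : w + (0, 1) + (0, -1) = w := by ext <;> simp
    suffices ∃ k, F (w + (0, 1)) k ≠ 0 by
      obtain ⟨k, hk⟩ := this
      refine ⟨(w + (0, 1), k), ?_⟩
      by_contra h
      exact hk (hE _ h)
    by_cases hbS : w + (0, 1) ∈ S
    · have h0 : g (w + (0, 1) + (0, 1)) = 0 := by
        by_contra h
        have := hmax _ (Finset.mem_filter.2 ⟨(Finset.mem_filter.1 (hw _ h)).1, h⟩)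
        simp only [Prod.snd_add] at this
        omega
      have h1 := hk' _ hbS hb
      rw [h0, eS, zero_add] at h1
      by_contra! hcon
      have h4 := hcon 4
      have h5 := hcon 5
      simp [hF, flowOf, hb, hbS, h0] at h4 h5
      rw [h4, h5, add_zero] at h1
      exact hgw h1
    · refine ⟨2, ?_⟩
      simpa [hF, flowOf, hb, hbS, eS] using hgw
  -- local relations
  have rNE : ∀ b, IsBlackCell b → F b 0 - F b 1 + F b 4 = g (b + (0, 1)) - g (b + (1, 0)) := by
    intro b hb
    by_cases hbS : b ∈ S <;> simp [hF, flowOf, hb, hbS]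
  have rNW : ∀ b, IsBlackCell b → F b 0 - F b 3 + F b 5 = g (b + (0, 1)) - g (b + (-1, 0)) := by
    intro b hb
    by_cases hbS : b ∈ S <;> simp [hF, flowOf, hb, hbS]
  have rSE : ∀ b, IsBlackCell b → F b 1 - F b 2 + F b 5 = g (b + (1, 0)) - g (b + (0, -1)) := by
    intro b hb
    by_cases hbS : b ∈ S
    · have := hk' b hbS hb
      simp only [hF, flowOf, hb, hbS, if_true]
      simp
      rw [sub_eq_sub_iff_add_eq_add, this]
    · simp [hF, flowOf, hb, hbS]
  have rSW : ∀ b, IsBlackCell b → F b 3 - F b 2 + F b 4 = g (b + (-1, 0)) - g (b + (0, -1)) := by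
    intro b hb
    by_cases hbS : b ∈ S
    · have := hk' b hbS hb
      simp only [hF, flowOf, hb, hbS, if_true]
      simp
      rw [sub_eq_sub_iff_add_eq_add, this, add_comm]
    · simp [hF, flowOf, hb, hbS]
  have hcons : ∀ v : Cell, F (v - (0, 1)) 0 + F (v - (1, 1)) 1 + F (v - (1, 0)) 2 + F v 3 + F v 4
      + F (v - (0, 1)) 5 = F (v - (1, 1)) 0 + F (v - (1, 0)) 1 + F v 2 + F (v - (0, 1)) 3
      + F (v - (1, 1)) 4 + F (v - (1, 0)) 5 := by
    intro v
    by_cases hv : IsBlackCell v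
    · have z1 := Fw (v - (0, 1)) (by
        simp only [IsBlackCell, Int.even_iff, Prod.fst_sub, Prod.snd_sub] at hv ⊢; omega)
      have z2 := Fw (v - (1, 0)) (by
        simp only [IsBlackCell, Int.even_iff, Prod.fst_sub, Prod.snd_sub] at hv ⊢; omega)
      have n1 := rSW v hv
      have n2 := rNE (v - (1, 1)) (by
        simp only [IsBlackCell, Int.even_iff, Prod.fst_sub, Prod.snd_sub] at hv ⊢; omega)
      have e1 : v - (1, 1) + (0, 1) = v + (-1, 0) := by ext <;> simp; ring
      have e2 : v - (1, 1) + (1, 0) = v + (0, -1) := by ext <;> simp; ring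
      rw [e1, e2, ← n1] at n2
      simp only [z1, z2, zero_add, add_zero]
      have n3 := congrArg (fun z => z + F (v - (1, 1)) 1 + F v 2) n2
      have l1 : F (v - (1, 1)) 0 - F (v - (1, 1)) 1 + F (v - (1, 1)) 4 + F (v - (1, 1)) 1 + F v 2
        = F (v - (1, 1)) 0 + F v 2 + F (v - (1, 1)) 4 := by abel
      have l2 : F v 3 - F v 2 + F v 4 + F (v - (1, 1)) 1 + F v 2
        = F (v - (1, 1)) 1 + F v 3 + F v 4 := by abel
      rw [l1, l2] at n3
      exact n3.symm
    · have z1 := Fw (v - (1, 1)) (by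
        simp only [IsBlackCell, Int.even_iff, Prod.fst_sub, Prod.snd_sub] at hv ⊢; omega)
      have z2 := Fw v hv
      have n1 := rNW (v - (0, 1)) (by
        simp only [IsBlackCell, Int.even_iff, Prod.fst_sub, Prod.snd_sub] at hv ⊢; omega)
      have n2 := rSE (v - (1, 0)) (by
        simp only [IsBlackCell, Int.even_iff, Prod.fst_sub, Prod.snd_sub] at hv ⊢; omega)
      have e1 : v - (0, 1) + (0, 1) = v := by simp
      have e2 : v - (1, 0) + (1, 0) = v := by simp
      have e3 : v - (0, 1) + (-1, 0) = v - (1, 0) + (0, -1) := by ext <;> simp <;> ring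
      rw [e1, e3] at n1
      rw [e2, ← n1] at n2
      simp only [z1, z2, zero_add, add_zero]
      have n3 := congrArg (fun z => z + F (v - (1, 0)) 2 + F (v - (0, 1)) 3) n2
      have l1 : F (v - (1, 0)) 1 - F (v - (1, 0)) 2 + F (v - (1, 0)) 5 + F (v - (1, 0)) 2
        + F (v - (0, 1)) 3
        = F (v - (1, 0)) 1 + F (v - (0, 1)) 3 + F (v - (1, 0)) 5 := by abel
      have l2 : F (v - (0, 1)) 0 - F (v - (0, 1)) 3 + F (v - (0, 1)) 5 + F (v - (1, 0)) 2
        + F (v - (0, 1)) 3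
        = F (v - (0, 1)) 0 + F (v - (1, 0)) 2 + F (v - (0, 1)) 5 := by abel
      rw [l1, l2] at n3
      exact n3.symm
  have z0 : ∀ v : Cell, v - (0, 0) = v := fun v => by ext <;> simp
  obtain ⟨ψ, hψ1, ⟨e1, he1⟩, hψ2⟩ := flow_lift φ E (fun e => e.1 + srcOff e.2)
    (fun e => e.1 + tgtOff e.2) hE' hEne (by
      intro v
      rw [sum_off E φ hE srcOff v, sum_off E φ hE tgtOff v, Fin.sum_univ_six, Fin.sum_univ_six]
      have := hcons v
      simp only [φ, srcOff, tgtOff]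
      simp only [Matrix.cons_val, z0]
      exact this)
  have hψ3 : ∀ b k, F b k = 0 → ψ (b, k) = 0 := by
    intro b k h
    apply hψ1
    intro hmem
    exact hE' _ hmem h
  refine kernel_of_flow S hole (fun b k => ψ (b, k)) ?_ (M + 1) ?_ ⟨e1.1, e1.2, he1⟩
  · refine ⟨?_, ?_, ?_, ?_, ?_, ?_, ?_, ?_⟩
    · exact fun b hb k => hψ3 _ _ (Fw b hb k)
    · intro b hb
      refine ⟨hψ3 _ _ ?_, hψ3 _ _ ?_, hψ3 _ _ ?_, hψ3 _ _ ?_⟩ <;> simp [hF, flowOf, hb]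
    · intro b hb
      refine ⟨hψ3 _ _ ?_, hψ3 _ _ ?_⟩ <;> simp [hF, flowOf, hb]
    · intro b hb h
      exact hψ3 _ _ (by simp [hF, flowOf, hb, hS _ h])
    · intro b hb h
      exact hψ3 _ _ (by simp [hF, flowOf, hb, hS _ h])
    · intro b hb h
      exact hψ3 _ _ (by simp [hF, flowOf, hb, hS _ h])
    · intro b hb h
      exact hψ3 _ _ (by simp [hF, flowOf, hb, hS _ h])
    · intro v
      have := hψ2 v
      rw [sum_off E ψ hψ1 srcOff v, sum_off E ψ hψ1 tgtOff v, Fin.sum_univ_six,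
        Fin.sum_univ_six] at this
      simp only [srcOff, tgtOff] at this
      simp only [Matrix.cons_val, z0] at this
      exact this
  · intro b k h
    exact Fsupp b k fun h' => h (hψ3 _ _ h')

/-! ### Matrix assembly -/

lemma row_sum {R : Type*} [Ring R] {S : Finset Cell} {n : ℕ} (ω : Fin n ≃ whiteCells S)
    (f : Cell → R) (hf : ∀ c, f c ≠ 0 → c ∈ whiteCells S) (b : Cell) :
    (∑ j, (if Adjacent b (ω j : Cell) then (1 : R) else 0) * f (ω j)) =
      f (b + (0, 1)) + f (b + (0, -1)) + (f (b + (1, 0)) + f (b + (-1, 0))) := by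
  classical
  have key : ∀ c : Cell, (∑ j, if (ω j : Cell) = c then f (ω j) else 0) = f c := by
    intro c
    by_cases hc : c ∈ whiteCells S
    · rw [Finset.sum_eq_single (ω.symm ⟨c, hc⟩)]
      · simp
      · intro j _ hj
        rw [if_neg]
        intro h
        apply hj
        rw [Equiv.eq_symm_apply]
        exact Subtype.ext h
      · simp
    · have : f c = 0 := by
        by_contra h
        exact hc (hf c h)
      rw [this]
      refine Finset.sum_eq_zero fun j _ => ?_
      rw [if_neg]
      intro h
      exact hc (h ▸ (ω j).2)
  rw [← key (b + (0, 1)), ← key (b + (0, -1)), ← key (b + (1, 0)), ← key (b + (-1, 0)),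
    ← Finset.sum_add_distrib, ← Finset.sum_add_distrib, ← Finset.sum_add_distrib]
  refine Finset.sum_congr rfl fun j _ => ?_
  generalize (ω j : Cell) = w
  have hiff : Adjacent b w ↔
      (w = b + (0, 1) ∨ w = b + (0, -1) ∨ w = b + (1, 0) ∨ w = b + (-1, 0)) := by
    simp only [Adjacent, Prod.ext_iff, Prod.fst_sub, Prod.snd_sub, Prod.fst_add, Prod.snd_add]
    omega
  by_cases hadj : Adjacent b w
  · rw [if_pos hadj, one_mul]
    rcases hiff.1 hadj with rfl | rfl | rfl | rfl <;> simp
  · have := hadj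
    rw [hiff] at this
    push Not at this
    simp [hadj, this]

/-- Sign depending on the parity of the first coordinate. -/
def sgn (R : Type*) [Ring R] (c : Cell) : R := if Even c.1 then 1 else -1

lemma sgn_mul_self (R : Type*) [Ring R] (c : Cell) : sgn R c * sgn R c = 1 := by
  unfold sgn
  split_ifs <;> simp

lemma sgn_mul_ne (R : Type*) [Ring R] (c : Cell) (x : R) : sgn R c * x ≠ 0 ↔ x ≠ 0 := by
  unfold sgn
  split_ifs <;> simp

lemma sgn_vert (R : Type*) [Ring R] (b : Cell) (y : ℤ) : sgn R (b + (0, y)) = sgn R b := by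
  simp [sgn]

lemma sgn_right (R : Type*) [Ring R] (b : Cell) : sgn R (b + (1, 0)) = - sgn R b := by
  simp only [sgn, Prod.fst_add, Int.even_add_one]
  split_ifs <;> simp_all

lemma sgn_left (R : Type*) [Ring R] (b : Cell) : sgn R (b + (-1, 0)) = - sgn R b := by
  have := sgn_right R (b + (-1, 0))
  have e : b + (-1, 0) + (1, 0) = b := by ext <;> simp
  rw [e] at this
  rw [this, neg_neg]

lemma exists_mod_prime {S : Finset Cell} {n : ℕ} (hole : ∀ U : Finset Cell, U.Nonempty →
      (∀ c ∈ U, c ∉ S) → ∃ c ∈ U, ∃ d, Adjacent c d ∧ d ∉ S ∧ d ∉ U)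
    (β : Fin n ≃ blackCells S) (ω : Fin n ≃ whiteCells S) (p : ℕ) (hp : p.Prime)
    (hdvd : (p : ℤ) ∣ (btwMatrix β ω).det) : (btwMatrix β ω).det = 0 := by
  classical
  have := Fact.mk hp
  have hdet : ((btwMatrix β ω).map (Int.castRingHom (ZMod p))).det = 0 := by
    rw [← RingHom.mapMatrix_apply, ← RingHom.map_det]
    simpa using (ZMod.intCast_zmod_eq_zero_iff_dvd _ p).2 hdvd
  obtain ⟨v, hv0, hv⟩ := Matrix.exists_mulVec_eq_zero_iff.2 hdet
  let f : Cell → ZMod p := fun c => if h : c ∈ whiteCells S then v (ω.symm ⟨c, h⟩) else 0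
  have hf : ∀ c, f c ≠ 0 → c ∈ whiteCells S := by
    intro c hc
    by_contra h
    exact hc (by simp [f, h])
  have hfω : ∀ j, f (ω j) = v j := by
    intro j
    simp [f]
  obtain ⟨g, ⟨c, hc⟩, hgw, hgk⟩ := lift_kernel S hole (fun c => sgn (ZMod p) c * f c)
    (by
      obtain ⟨j, hj⟩ := Function.ne_iff.1 hv0
      refine ⟨ω j, ?_⟩
      rw [sgn_mul_ne, hfω]
      exact hj)
    (by
      intro c hc
      rw [sgn_mul_ne] at hc
      exact hf c hc)
    (by
      intro b hb
      have h1 := congrFun hv (β.symm ⟨b, hb⟩)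
      have h2 := row_sum ω f hf b
      have h3 : f (b + (0, 1)) + f (b + (0, -1)) + (f (b + (1, 0)) + f (b + (-1, 0))) = 0 := by
        rw [← h2]
        simp only [Matrix.mulVec, dotProduct, Matrix.map_apply, btwMatrix, Pi.zero_apply,
          Equiv.apply_symm_apply] at h1
        refine Eq.trans ?_ h1
        refine Finset.sum_congr rfl fun j _ => ?_
        rw [hfω]
        split_ifs <;> simp
      simp only [sgn_vert, sgn_right, sgn_left]
      linear_combination (sgn (ZMod p) b) * h3)
  refine Matrix.exists_mulVec_eq_zero_iff.1 ⟨fun j => sgn ℤ (ω j : Cell) * g (ω j), ?_, ?_⟩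
  · rw [Function.ne_iff]
    refine ⟨ω.symm ⟨c, hgw c hc⟩, ?_⟩
    simp only [Equiv.apply_symm_apply, Pi.zero_apply]
    rw [sgn_mul_ne]
    exact hc
  · funext i
    have h1 := row_sum ω (fun c => sgn ℤ c * g c) (by
      intro c hc
      rw [sgn_mul_ne] at hc
      exact hgw c hc) (β i)
    simp only [Matrix.mulVec, dotProduct, btwMatrix, Pi.zero_apply]
    rw [h1]
    have h2 := hgk _ (β i).2
    simp only [sgn_vert, sgn_right, sgn_left]
    linear_combination (sgn ℤ (β i : Cell)) * h2

end DT

/-- **Theorem (Deift–Tomei).** For a board with equally many black and white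
cells, the determinant of its black-to-white matrix equals 0, 1 or -1. -/
theorem det_btwMatrix_eq_zero_or_one_or_neg_one
    (S : Finset Cell) (hS : IsBoard S) (n : ℕ)
    (β : Fin n ≃ blackCells S) (ω : Fin n ≃ whiteCells S) :
    (btwMatrix β ω).det = 0 ∨ (btwMatrix β ω).det = 1 ∨ (btwMatrix β ω).det = -1 := by
  have hole := DT.no_hole S hS
  by_contra! hcon
  obtain ⟨h0, h1, h2⟩ := hcon
  obtain ⟨p, hp, hdvd⟩ := Nat.exists_prime_and_dvd (n := (btwMatrix β ω).det.natAbs) (by omega)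
  exact h0 (DT.exists_mod_prime hole β ω p hp (Int.natCast_dvd.2 hdvd))
end

section
/- Let S be a board whose number of black cells equals its number of white cells, say both equal to n, and fix bijections β : Fin n ≃ {black cells of S} and ω : Fin n ≃ {white cells of S}. Let T be the (finite) set of domino tilings of S. Then there exist a subset T* ⊆ T whose complement T \ T* has at most one element, and an involution ρ : T* → T* (ρ ∘ ρ = id) such that for every τ ∈ T*, the permutations π_τ and π_{ρ(τ)} have opposite signs. -/
open scoped Matrix

/-- A domino: an unordered pair of adjacent cells. -/
def IsDomino (d : Finset Cell) : Prop := ∃ p q : Cell, Adjacent p q ∧ d = {p, q}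

/-- A domino tiling of `S`: a partition of `S` into dominoes. -/
def IsTiling (S : Finset Cell) (τ : Finset (Finset Cell)) : Prop :=
  (∀ d ∈ τ, IsDomino d) ∧ (∀ d ∈ τ, d ⊆ S) ∧ (∀ p ∈ S, ∃! d, d ∈ τ ∧ p ∈ d)

/-- `π` is the permutation associated to the tiling `τ` via the labelings
`β`, `ω`: `π j = i` iff the `i`-th black cell and the `j`-th white cell form a
domino of `τ`. -/
def PermRepresents {S : Finset Cell} {n : ℕ}
    (β : Fin n ≃ blackCells S) (ω : Fin n ≃ whiteCells S)
    (τ : Finset (Finset Cell)) (π : Equiv.Perm (Fin n)) : Prop :=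
  ∀ i j, π j = i ↔ ({(β i : Cell), (ω j : Cell)} : Finset Cell) ∈ τ

/-- Relative position of a point of the plane with respect to the centre of a cell. -/
noncomputable def relPos (c : Cell) (x : ℝ × ℝ) : ℂ :=
  ⟨x.1 - c.1 - 1 / 2, x.2 - c.2 - 1 / 2⟩

/-- The centre of a cell. -/
noncomputable def center (p : Cell) : ℝ × ℝ := ((p.1 : ℝ) + 1 / 2, (p.2 : ℝ) + 1 / 2)

lemma mem_Region {S : Finset Cell} {x : ℝ × ℝ} :
    x ∈ Region S ↔ ∃ p ∈ S, ((p.1 : ℝ) ≤ x.1 ∧ x.1 ≤ p.1 + 1) ∧ ((p.2 : ℝ) ≤ x.2 ∧ x.2 ≤ p.2 + 1) := by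
  simp only [Region, unitSquare, Set.mem_iUnion, Set.mem_prod, Set.mem_Icc, exists_prop]

lemma continuous_relPos (c : Cell) : Continuous (relPos c) := by
  have : relPos c = fun x : ℝ × ℝ =>
      ((x.1 - c.1 - 1 / 2 : ℝ) : ℂ) + ((x.2 - c.2 - 1 / 2 : ℝ) : ℂ) * Complex.I := by
    funext x
    apply Complex.ext <;> simp [relPos]
  rw [this]
  fun_prop

lemma relPos_ne_zero {S : Finset Cell} {c : Cell} (hc : c ∉ S) {x : ℝ × ℝ} (hx : x ∈ Region S) :
    relPos c x ≠ 0 := by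
  intro h
  have h1 := congrArg Complex.re h
  have h2 := congrArg Complex.im h
  simp only [relPos, Complex.zero_re, Complex.zero_im] at h1 h2
  obtain ⟨p, hp, ⟨a1, a2⟩, b1, b2⟩ := mem_Region.1 hx
  apply hc
  have e1 : p.1 = c.1 := by
    have : (p.1 : ℝ) < c.1 + 1 := by linarith
    have h3 : (c.1 : ℝ) < p.1 + 1 := by linarith
    norm_cast at this h3
    omega
  have e2 : p.2 = c.2 := by
    have : (p.2 : ℝ) < c.2 + 1 := by linarith
    have h3 : (c.2 : ℝ) < p.2 + 1 := by linarith
    norm_cast at this h3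
    omega
  rwa [← Prod.ext e1 e2]

/-- A continuous logarithm of the relative position exists on a board. -/
lemma exists_log {S : Finset Cell} (hS : IsBoard S) {c : Cell} (hc : c ∉ S) :
    ∃ L : ℝ × ℝ → ℂ, ContinuousOn L (Region S) ∧
      ∀ x ∈ Region S, Complex.exp (L x) = relPos c x := by
  classical
  obtain ⟨_, ⟨e⟩⟩ := hS
  have hconv : Convex ℝ (Metric.closedBall (0 : EuclideanSpace ℝ (Fin 2)) 1) :=
    convex_closedBall _ _
  have hne : (Metric.closedBall (0 : EuclideanSpace ℝ (Fin 2)) 1).Nonempty :=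
    ⟨0, by simp⟩
  have := hconv.contractibleSpace hne
  have := hconv.locallyPathConnectedSpace
  let f : C(Metric.closedBall (0 : EuclideanSpace ℝ (Fin 2)) 1, ℂ) :=
    ⟨fun y => relPos c (e.symm y : ℝ × ℝ),
      (continuous_relPos c).comp (continuous_subtype_val.comp e.symm.continuous)⟩
  have hf : ∀ y, f y ≠ 0 := fun y => relPos_ne_zero hc (e.symm y).2
  obtain ⟨F, ⟨-, hF⟩, -⟩ := Complex.isCoveringMapOn_exp.existsUnique_continuousMap_lifts f
    (a₀ := ⟨0, by simp⟩) (Complex.exp_log (hf _)) (fun y => hf y)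
  refine ⟨fun x => if hx : x ∈ Region S then F (e ⟨x, hx⟩) else 0, ?_, ?_⟩
  · rw [continuousOn_iff_continuous_domRestrict]
    have : Continuous fun x : Region S => F (e x) := F.continuous.comp e.continuous
    convert this using 1
    funext x
    simp
  · intro x hx
    have := congrFun hF (e ⟨x, hx⟩)
    simpa [hx, f] using this

/-- On a connected set where a branch of the argument exists, the lifted angle follows it. -/
lemma angle_const {R A : Set (ℝ × ℝ)} {L : ℝ × ℝ → ℂ} {c : Cell} (hL : ContinuousOn L R)
    (hexp : ∀ x ∈ R, Complex.exp (L x) = relPos c x) (hAR : A ⊆ R) (hA : IsPreconnected A)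
    (u : ℂ) (hu : u ≠ 0) (hsl : ∀ x ∈ A, u * relPos c x ∈ Complex.slitPlane)
    {x y : ℝ × ℝ} (hx : x ∈ A) (hy : y ∈ A) :
    (L y).im - (u * relPos c y).arg = (L x).im - (u * relPos c x).arg := by
  set D : ℝ × ℝ → ℂ := fun z => L z - Complex.log (u * relPos c z) with hD
  have hDc : ContinuousOn D A := by
    apply (hL.mono hAR).sub
    apply ContinuousOn.clog _ hsl
    exact (continuous_const.mul (continuous_relPos c)).continuousOn
  have hDe : ∀ z ∈ A, Complex.exp (D z) = u⁻¹ := by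
    intro z hz
    have h0 : u * relPos c z ≠ 0 := Complex.slitPlane_ne_zero (hsl z hz)
    have h1 : relPos c z ≠ 0 := right_ne_zero_of_mul h0
    rw [hD]
    simp only
    rw [Complex.exp_sub, Complex.exp_log h0, hexp z (hAR hz)]
    field_simp
  have key : ∀ z ∈ A, ∃ n : ℤ, ((n : ℝ)) = ((D z).im - (D x).im) / (2 * Real.pi) := by
    intro z hz
    have h := (hDe z hz).trans (hDe x hx).symm
    obtain ⟨n, hn⟩ := Complex.exp_eq_exp_iff_exists_int.1 h
    refine ⟨n, ?_⟩
    rw [hn]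
    simp
  have hT : IsDiscrete (Set.range ((↑) : ℤ → ℝ)) := by
    rw [isDiscrete_iff_discreteTopology]
    exact (Int.isClosedEmbedding_coe_real.isEmbedding.toHomeomorph).symm.isEmbedding.discreteTopology
  have hcont : ContinuousOn (fun z => ((D z).im - (D x).im) / (2 * Real.pi)) A := by
    apply ContinuousOn.div_const
    apply ContinuousOn.sub _ continuousOn_const
    exact Complex.continuous_im.comp_continuousOn hDc
  have := hA.constant_of_mapsTo hT hcont (fun z hz => key z hz) hx hy
  simp only [sub_self, zero_div] at this
  have hpi := Real.pi_pos
  have h2 : (D y).im - (D x).im = 0 := by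
    have h3 := this.symm
    rw [div_eq_zero_iff] at h3
    rcases h3 with h | h
    · exact h
    · linarith
  simp only [hD, Complex.sub_im, Complex.log_im] at h2
  linarith

lemma arg_neg_slit {z : ℂ} (hz : z ∈ Complex.slitPlane) :
    (-z).arg = z.arg + if 0 < z.im then -Real.pi else Real.pi := by
  rw [Complex.mem_slitPlane_iff] at hz
  split_ifs with h
  · rw [Complex.arg_neg_eq_arg_sub_pi_of_im_pos h]; ring
  · rcases lt_or_eq_of_le (not_lt.1 h) with h1 | h1
    · rw [Complex.arg_neg_eq_arg_add_pi_of_im_neg h1]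
    · have hre : 0 < z.re := by
        rcases hz with h2 | h2
        · exact h2
        · exact absurd h1 h2
      rw [Complex.arg_neg_eq_arg_add_pi_iff]
      exact Or.inr ⟨h1, hre⟩

lemma relPos_center_re (c p : Cell) : (relPos c (center p)).re = ((p.1 - c.1 : ℤ) : ℝ) := by
  simp [relPos, center]; ring

lemma relPos_center_im (c p : Cell) : (relPos c (center p)).im = ((p.2 - c.2 : ℤ) : ℝ) := by
  simp [relPos, center]; ring

lemma center_mem {S : Finset Cell} {p : Cell} (hp : p ∈ S) : center p ∈ Region S := by
  rw [mem_Region]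
  refine ⟨p, hp, ?_⟩
  simp only [center]
  refine ⟨⟨?_, ?_⟩, ?_, ?_⟩ <;> linarith

/-- Winding-number form of simple connectivity. -/
lemma exists_cut {S : Finset Cell} (hS : IsBoard S) {c : Cell} (hc : c ∉ S) :
    ∃ m : Cell → ℤ,
      (∀ x y : ℤ, (x, y) ∈ S → (x + 1, y) ∈ S → m (x + 1, y) - m (x, y) = 0) ∧
      (∀ x y : ℤ, (x, y) ∈ S → (x, y + 1) ∈ S →
        m (x, y + 1) - m (x, y) = if y = c.2 ∧ c.1 < x then 1 else 0) := by
  classical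
  obtain ⟨L, hL, hexp⟩ := exists_log hS hc
  have hpi := Real.pi_pos
  have hm : ∀ p : Cell, ∃ n : ℤ, p ∈ S →
      (L (center p)).im = (-relPos c (center p)).arg + Real.pi + n * (2 * Real.pi) := by
    intro p
    by_cases hp : p ∈ S
    · have h0 := relPos_ne_zero hc (center_mem hp)
      have h1 : Complex.exp (L (center p)) =
          Complex.exp (Complex.log (-relPos c (center p)) + Real.pi * Complex.I) := by
        rw [hexp _ (center_mem hp), Complex.exp_add, Complex.exp_log (neg_ne_zero.2 h0),
          Complex.exp_pi_mul_I]
        ring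
      obtain ⟨n, hn⟩ := Complex.exp_eq_exp_iff_exists_int.1 h1
      refine ⟨n, fun _ => ?_⟩
      rw [hn]
      simp [Complex.log_im]
    · exact ⟨0, fun h => absurd h hp⟩
  choose m hm using hm
  -- jump along an edge on which one of the two branches is available
  have jumpPos : ∀ p q : Cell, p ∈ S → q ∈ S → ∀ A : Set (ℝ × ℝ), A ⊆ Region S →
      IsPreconnected A → center p ∈ A → center q ∈ A →
      (∀ x ∈ A, relPos c x ∈ Complex.slitPlane) →
      m q - m p = (if 0 < p.2 - c.2 then -1 else 0) - (if 0 < q.2 - c.2 then -1 else 0) := by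
    intro p q hp hq A hAR hA hpA hqA hsl
    have h := angle_const hL hexp hAR hA 1 one_ne_zero (by simpa using hsl) hpA hqA
    simp only [one_mul] at h
    rw [hm p hp, hm q hq, arg_neg_slit (hsl _ hpA), arg_neg_slit (hsl _ hqA),
      relPos_center_im, relPos_center_im] at h
    simp only [Int.cast_pos] at h
    have h3 : ((m q - m p : ℤ) : ℝ) = (((if 0 < p.2 - c.2 then -1 else 0) -
        (if 0 < q.2 - c.2 then -1 else 0) : ℤ) : ℝ) := by
      have : ((m q : ℝ) - m p) * (2 * Real.pi) =
        (if 0 < p.2 - c.2 then -Real.pi else Real.pi) -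
          (if 0 < q.2 - c.2 then -Real.pi else Real.pi) := by linarith
      have h2 : (2 * Real.pi) ≠ 0 := by positivity
      push_cast
      apply mul_right_cancel₀ h2
      rw [this]
      split_ifs <;> ring
    exact_mod_cast h3
  have jumpNeg : ∀ p q : Cell, p ∈ S → q ∈ S → ∀ A : Set (ℝ × ℝ), A ⊆ Region S →
      IsPreconnected A → center p ∈ A → center q ∈ A →
      (∀ x ∈ A, -relPos c x ∈ Complex.slitPlane) →
      m q - m p = 0 := by
    intro p q hp hq A hAR hA hpA hqA hsl
    have h := angle_const hL hexp hAR hA (-1) (by simp) (by simpa using hsl) hpA hqA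
    simp only [neg_mul, one_mul] at h
    rw [hm p hp, hm q hq] at h
    have h3 : ((m q - m p : ℤ) : ℝ) = ((0 : ℤ) : ℝ) := by
      have : ((m q : ℝ) - m p) * (2 * Real.pi) = 0 := by linarith
      have h2 : (2 * Real.pi) ≠ 0 := by positivity
      push_cast
      apply mul_right_cancel₀ h2
      rw [this]
      ring
    exact_mod_cast h3
  refine ⟨m, ?_, ?_⟩
  · intro x y hp hq
    set A : Set (ℝ × ℝ) := Set.Icc ((x : ℝ) + 1 / 2) (x + 3 / 2) ×ˢ
      Set.Icc ((y : ℝ) + 1 / 2) (y + 1 / 2) with hAdef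
    have hA : IsPreconnected A := isPreconnected_Icc.prod isPreconnected_Icc
    have hAR : A ⊆ Region S := by
      rintro ⟨a, b⟩ ⟨⟨h1, h2⟩, h3, h4⟩
      simp only at h1 h2 h3 h4
      rw [mem_Region]
      by_cases h : a ≤ x + 1
      · exact ⟨_, hp, by simp only; constructor <;> constructor <;> linarith⟩
      · exact ⟨_, hq, by
          push_cast; constructor <;> constructor <;> linarith⟩
    have hpA : center (x, y) ∈ A := by
      simp only [hAdef, center, Set.mem_prod, Set.mem_Icc]
      refine ⟨⟨?_, ?_⟩, ?_, ?_⟩ <;> linarith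
    have hqA : center (x + 1, y) ∈ A := by
      simp only [hAdef, center, Set.mem_prod, Set.mem_Icc]
      push_cast
      refine ⟨⟨?_, ?_⟩, ?_, ?_⟩ <;> linarith
    have hne1 : ¬ (x = c.1 ∧ y = c.2) := by
      rintro ⟨h1, h2⟩; exact hc (by rw [h1, h2] at hp; exact hp)
    have hne2 : ¬ (x + 1 = c.1 ∧ y = c.2) := by
      rintro ⟨h1, h2⟩; exact hc (by rw [h1, h2] at hq; exact hq)
    by_cases hcase : y = c.2 ∧ x + 1 < c.1
    · refine jumpNeg _ _ hp hq A hAR hA hpA hqA ?_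
      rintro ⟨a, b⟩ ⟨⟨h1, h2⟩, h3, h4⟩
      simp only at h1 h2 h3 h4
      have : (x : ℝ) + 1 + 1 ≤ c.1 := by exact_mod_cast hcase.2
      left
      simp only [relPos, Complex.neg_re]
      linarith
    · have := jumpPos _ _ hp hq A hAR hA hpA hqA ?_
      · simpa using this
      rintro ⟨a, b⟩ ⟨⟨h1, h2⟩, h3, h4⟩
      simp only at h1 h2 h3 h4
      by_cases hy : y = c.2
      · have : c.1 + 1 ≤ x := by omega
        have : (c.1 : ℝ) + 1 ≤ x := by exact_mod_cast this
        left
        simp only [relPos]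
        linarith
      · right
        simp only [relPos]
        intro h
        apply hy
        have : (y : ℝ) = c.2 := by linarith
        exact_mod_cast this
  · intro x y hp hq
    set A : Set (ℝ × ℝ) := Set.Icc ((x : ℝ) + 1 / 2) (x + 1 / 2) ×ˢ
      Set.Icc ((y : ℝ) + 1 / 2) (y + 3 / 2) with hAdef
    have hA : IsPreconnected A := isPreconnected_Icc.prod isPreconnected_Icc
    have hAR : A ⊆ Region S := by
      rintro ⟨a, b⟩ ⟨⟨h1, h2⟩, h3, h4⟩
      simp only at h1 h2 h3 h4
      rw [mem_Region]
      by_cases h : b ≤ y + 1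
      · exact ⟨_, hp, by simp only; constructor <;> constructor <;> linarith⟩
      · exact ⟨_, hq, by
          push_cast; constructor <;> constructor <;> linarith⟩
    have hpA : center (x, y) ∈ A := by
      simp only [hAdef, center, Set.mem_prod, Set.mem_Icc]
      refine ⟨⟨?_, ?_⟩, ?_, ?_⟩ <;> linarith
    have hqA : center (x, y + 1) ∈ A := by
      simp only [hAdef, center, Set.mem_prod, Set.mem_Icc]
      push_cast
      refine ⟨⟨?_, ?_⟩, ?_, ?_⟩ <;> linarith
    have hne1 : ¬ (x = c.1 ∧ y = c.2) := by
      rintro ⟨h1, h2⟩; exact hc (by rw [h1, h2] at hp; exact hp)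
    have hne2 : ¬ (x = c.1 ∧ y + 1 = c.2) := by
      rintro ⟨h1, h2⟩; exact hc (by rw [h1, h2] at hq; exact hq)
    by_cases hcase : x < c.1
    · rw [if_neg (by omega)]
      refine jumpNeg _ _ hp hq A hAR hA hpA hqA ?_
      rintro ⟨a, b⟩ ⟨⟨h1, h2⟩, h3, h4⟩
      simp only at h1 h2 h3 h4
      have : (x : ℝ) + 1 ≤ c.1 := by exact_mod_cast hcase
      left
      simp only [relPos, Complex.neg_re]
      linarith
    · have := jumpPos _ _ hp hq A hAR hA hpA hqA ?_
      · rw [this]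
        simp only
        split_ifs <;> omega
      rintro ⟨a, b⟩ ⟨⟨h1, h2⟩, h3, h4⟩
      simp only at h1 h2 h3 h4
      by_cases hx : x = c.1
      · right
        simp only [relPos]
        intro h
        have h5 : y < c.2 ∨ c.2 < y := by omega
        rcases h5 with h5 | h5
        · have : y + 2 ≤ c.2 := by omega
          have : (y : ℝ) + 2 ≤ c.2 := by exact_mod_cast this
          linarith
        · have : (c.2 : ℝ) + 1 ≤ y := by exact_mod_cast h5
          linarith
      · have : c.1 + 1 ≤ x := by omega
        have : (c.1 : ℝ) + 1 ≤ x := by exact_mod_cast this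
        left
        simp only [relPos]
        linarith

/-- Cut function attached to a `2 × 2` block that is not contained in `S`. -/
lemma exists_blockCut {S : Finset Cell} (hS : IsBoard S) (x₀ y₀ : ℤ)
    (h : ¬ ((x₀, y₀) ∈ S ∧ (x₀ + 1, y₀) ∈ S ∧ (x₀, y₀ + 1) ∈ S ∧ (x₀ + 1, y₀ + 1) ∈ S)) :
    ∃ m : Cell → ℤ,
      (∀ x y : ℤ, (x, y) ∈ S → (x + 1, y) ∈ S → m (x + 1, y) - m (x, y) = 0) ∧
      (∀ x y : ℤ, (x, y) ∈ S → (x, y + 1) ∈ S →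
        m (x, y + 1) - m (x, y) = if y = y₀ ∧ x₀ < x then 1 else 0) := by
  have h' : ∃ c : Cell, c ∉ S ∧ (c.1 = x₀ ∨ c.1 = x₀ + 1) ∧ (c.2 = y₀ ∨ c.2 = y₀ + 1) := by
    by_contra hcon
    push Not at hcon
    apply h
    refine ⟨?_, ?_, ?_, ?_⟩ <;>
    · by_contra hc
      have := hcon _ hc
      simp at this
  obtain ⟨c, hc, hc1, hc2⟩ := h'
  obtain ⟨m, hm1, hm2⟩ := exists_cut hS hc
  rcases hc2 with hc2 | hc2
  · refine ⟨m, hm1, ?_⟩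
    intro x y hp hq
    rw [hm2 x y hp hq]
    have hne : ¬ (x = c.1 ∧ y = c.2) := by
      rintro ⟨h1, h2⟩; exact hc (by rw [h1, h2] at hp; exact hp)
    split_ifs <;> omega
  · refine ⟨fun p => m p + if p.2 = c.2 ∧ c.1 < p.1 then 1 else 0, ?_, ?_⟩
    · intro x y hp hq
      have hne : ¬ (x = c.1 ∧ y = c.2) := by
        rintro ⟨h1, h2⟩; exact hc (by rw [h1, h2] at hp; exact hp)
      have := hm1 x y hp hq
      simp only
      split_ifs <;> omega
    · intro x y hp hq
      have hne : ¬ (x = c.1 ∧ y + 1 = c.2) := by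
        rintro ⟨h1, h2⟩; exact hc (by rw [h1, h2] at hq; exact hq)
      have := hm2 x y hp hq
      simp only
      split_ifs at this ⊢ <;> omega

/-- Discrete Poincaré lemma on a board. -/
lemma poincare {S : Finset Cell} (hS : IsBoard S) {K : Type*} [CommRing K]
    (a b : ℤ → ℤ → K)
    (hclosed : ∀ x y : ℤ, (x, y) ∈ S → (x + 1, y) ∈ S → (x, y + 1) ∈ S → (x + 1, y + 1) ∈ S →
      a x y + b (x + 1) y - a x (y + 1) - b x y = 0) :
    ∃ φ : Cell → K,
      (∀ x y : ℤ, (x, y) ∈ S → (x + 1, y) ∈ S → φ (x + 1, y) - φ (x, y) = a x y) ∧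
      (∀ x y : ℤ, (x, y) ∈ S → (x, y + 1) ∈ S → φ (x, y + 1) - φ (x, y) = b x y) := by
  classical
  -- truncate the form to the edges of `S`
  set a' : ℤ → ℤ → K := fun x y => if (x, y) ∈ S ∧ (x + 1, y) ∈ S then a x y else 0 with ha'
  set b' : ℤ → ℤ → K := fun x y => if (x, y) ∈ S ∧ (x, y + 1) ∈ S then b x y else 0 with hb'
  set κ : ℤ → ℤ → K := fun x y => a' x y + b' (x + 1) y - a' x (y + 1) - b' x y with hκ
  have hκ0 : ∀ x y, κ x y ≠ 0 →
      ¬ ((x, y) ∈ S ∧ (x + 1, y) ∈ S ∧ (x, y + 1) ∈ S ∧ (x + 1, y + 1) ∈ S) := by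
    rintro x y hne ⟨h1, h2, h3, h4⟩
    apply hne
    simp only [hκ, ha', hb', h1, h2, h3, h4, and_self, if_true]
    exact hclosed x y h1 h2 h3 h4
  have hm : ∀ v : ℤ × ℤ, ∃ m : Cell → ℤ, κ v.1 v.2 ≠ 0 →
      (∀ x y : ℤ, (x, y) ∈ S → (x + 1, y) ∈ S → m (x + 1, y) - m (x, y) = 0) ∧
      (∀ x y : ℤ, (x, y) ∈ S → (x, y + 1) ∈ S →
        m (x, y + 1) - m (x, y) = if y = v.2 ∧ v.1 < x then 1 else 0) := by
    intro v
    by_cases hv : κ v.1 v.2 = 0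
    · exact ⟨0, fun h => absurd hv h⟩
    · obtain ⟨m, h⟩ := exists_blockCut hS v.1 v.2 (hκ0 _ _ hv)
      exact ⟨m, fun _ => h⟩
  choose m hm using hm
  -- a bound for the board
  obtain ⟨N, hN⟩ : ∃ N : ℤ, ∀ p ∈ S, -N < p.1 ∧ p.1 < N ∧ -N < p.2 ∧ p.2 < N := by
    refine ⟨(∑ p ∈ S, (|p.1| + |p.2|)) + 1, fun p hp => ?_⟩
    have h1 : |p.1| + |p.2| ≤ ∑ p ∈ S, (|p.1| + |p.2|) :=
      Finset.single_le_sum (f := fun p : Cell => |p.1| + |p.2|)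
        (fun q _ => by positivity) hp
    have h2 := abs_le.1 (le_refl |p.1|)
    have h3 := abs_le.1 (le_refl |p.2|)
    have h4 := abs_nonneg p.1
    have h5 := abs_nonneg p.2
    refine ⟨?_, ?_, ?_, ?_⟩ <;> linarith
  set φ₀ : ℤ → ℤ → K := fun x y => ∑ k ∈ Finset.Ico (-N) x, a' k y with hφ₀
  have ico : ∀ (g : ℤ → K) (x : ℤ), -N ≤ x →
      ∑ k ∈ Finset.Ico (-N) (x + 1), g k = ∑ k ∈ Finset.Ico (-N) x, g k + g x := by
    intro g x hx
    have : Finset.Ico (-N) (x + 1) = insert x (Finset.Ico (-N) x) := by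
      ext k; simp only [Finset.mem_Ico, Finset.mem_insert]; omega
    rw [this, Finset.sum_insert (by simp)]
    ring
  have hvert : ∀ x y, -N ≤ x →
      b' x y = φ₀ x (y + 1) - φ₀ x y + ∑ k ∈ Finset.Ico (-N) x, κ k y := by
    intro x y hx
    induction x, hx using Int.leInduction with
    | base =>
      have : (-N, y) ∉ S := fun h => by have := (hN _ h).1; simp at this
      simp [hb', hφ₀, this]
    | succ x hx ih =>
      simp only [hφ₀] at ih ⊢
      rw [ico _ x hx, ico _ x hx, ico _ x hx]
      simp only [hκ] at ih ⊢
      linear_combination ih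
  set box := Finset.Ico (-N) N ×ˢ Finset.Ico (-N) N with hbox
  have hd1 : ∀ v : ℤ × ℤ, ∀ x y : ℤ, (x, y) ∈ S → (x + 1, y) ∈ S →
      κ v.1 v.2 * (m v (x + 1, y) : K) - κ v.1 v.2 * (m v (x, y) : K) = 0 := by
    intro v x y hp hq
    by_cases hv : κ v.1 v.2 = 0
    · simp [hv]
    · have := (hm v hv).1 x y hp hq
      rw [← mul_sub, ← Int.cast_sub, this]
      simp
  have hd2 : ∀ v : ℤ × ℤ, ∀ x y : ℤ, (x, y) ∈ S → (x, y + 1) ∈ S →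
      κ v.1 v.2 * (m v (x, y + 1) : K) - κ v.1 v.2 * (m v (x, y) : K) =
        if y = v.2 ∧ v.1 < x then κ v.1 v.2 else 0 := by
    intro v x y hp hq
    by_cases hv : κ v.1 v.2 = 0
    · simp [hv]
    · have := (hm v hv).2 x y hp hq
      rw [← mul_sub, ← Int.cast_sub, this]
      split_ifs <;> simp
  refine ⟨fun p => φ₀ p.1 p.2 + ∑ v ∈ box, κ v.1 v.2 * (m v p : K), ?_, ?_⟩
  · intro x y hp hq
    have hx := hN _ hp
    have h1 : ∑ v ∈ box, κ v.1 v.2 * (m v (x + 1, y) : K) -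
        ∑ v ∈ box, κ v.1 v.2 * (m v (x, y) : K) = 0 := by
      rw [← Finset.sum_sub_distrib]
      exact Finset.sum_eq_zero fun v _ => hd1 v x y hp hq
    have h2 : φ₀ (x + 1) y = φ₀ x y + a' x y := ico _ x hx.1.le
    have h3 : a' x y = a x y := by simp [ha', hp, hq]
    simp only
    rw [h2, h3]
    linear_combination h1
  · intro x y hp hq
    have hx := hN _ hp
    simp only at hx
    have h1 : ∑ v ∈ box, κ v.1 v.2 * (m v (x, y + 1) : K) -
        ∑ v ∈ box, κ v.1 v.2 * (m v (x, y) : K) = ∑ k ∈ Finset.Ico (-N) x, κ k y := by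
      rw [← Finset.sum_sub_distrib, Finset.sum_congr rfl fun v _ => hd2 v x y hp hq,
        ← Finset.sum_filter]
      have : box.filter (fun v => y = v.2 ∧ v.1 < x) = Finset.Ico (-N) x ×ˢ {y} := by
        ext ⟨k, l⟩
        simp only [hbox, Finset.mem_filter, Finset.mem_product, Finset.mem_Ico,
          Finset.mem_singleton]
        omega
      rw [this, Finset.sum_product]
      simp
    have h2 := hvert x y hx.1.le
    have h3 : b' x y = b x y := by simp [hb', hp, hq]
    simp only
    rw [← h3]
    linear_combination h1 - h2

/-- A nonzero solution of the discrete wave equation modulo `p` yields one over `ℤ`. -/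
lemma lift_wave {S : Finset Cell} (hS : IsBoard S) (p : ℕ) [NeZero p] (F : ℤ → ℤ → ZMod p)
    (hF0 : ∀ x y, (x, y) ∉ S → F x y = 0)
    (hF : ∀ x y, (x, y) ∈ S → ¬ Even (x + y) →
      F (x + 1) y + F (x - 1) y = F x (y + 1) + F x (y - 1)) :
    ∃ G : ℤ → ℤ → ℤ, (∀ x y, (x, y) ∉ S → G x y = 0) ∧
      (∀ x y, (x, y) ∈ S → ¬ Even (x + y) →
        G (x + 1) y + G (x - 1) y = G x (y + 1) + G x (y - 1)) ∧
      (∀ x y, F x y ≠ 0 → G x y ≠ 0) := by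
  classical
  set δ : ℤ → ℤ → ZMod p := fun x y => F (x + 1) y - F x (y - 1) with hδ
  obtain ⟨φ, hφ1, hφ2⟩ := poincare hS
    (fun x y => if Even (x + y) then 0 else δ x y)
    (fun x y => if Even (x + y) then 0 else δ x y) (by
      intro x y h1 h2 h3 h4
      have e1 : Even (x + 1 + y) ↔ ¬ Even (x + y) := by
        rw [show x + 1 + y = x + y + 1 by ring, Int.even_add_one]
      have e2 : Even (x + (y + 1)) ↔ ¬ Even (x + y) := by
        rw [show x + (y + 1) = x + y + 1 by ring, Int.even_add_one]
      simp only [e1, e2]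
      by_cases he : Even (x + y)
      · have w1 := hF (x + 1) y h2 (by rw [e1]; simpa using he)
        have w2 := hF x (y + 1) h3 (by rw [e2]; simpa using he)
        simp only [add_sub_cancel_right] at w1 w2
        simp only [he, hδ, not_true, if_true, if_false, add_sub_cancel_right]
        linear_combination w1
      · simp [he])
  -- values at the four neighbours of a white cell
  refine ⟨fun x y => if (x, y) ∈ S then ((φ (x, y)).val : ℤ) - (φ (x, y) - F x y).val else 0,
    ?_, ?_, ?_⟩
  · intro x y h
    simp [h]
  · intro x y h ho
    have w := hF x y h ho
    have em1 : Even (x - 1 + y) := by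
      rw [show x - 1 + y = x + y - 1 by ring]; rw [Int.even_sub_one]; exact ho
    have em2 : Even (x + (y - 1)) := by
      rw [show x + (y - 1) = x + y - 1 by ring]; rw [Int.even_sub_one]; exact ho
    have hE : (x + 1, y) ∈ S → φ (x + 1, y) = φ (x, y) + δ x y := by
      intro hh
      have := hφ1 x y h hh
      simp only [ho, if_false] at this
      linear_combination this
    have hN : (x, y + 1) ∈ S → φ (x, y + 1) = φ (x, y) + δ x y := by
      intro hh
      have := hφ2 x y h hh
      simp only [ho, if_false] at this
      linear_combination this
    have hW : (x - 1, y) ∈ S → φ (x - 1, y) = φ (x, y) := by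
      intro hh
      have := hφ1 (x - 1) y hh (by simpa using h)
      simp only [em1, if_true, sub_add_cancel] at this
      linear_combination -this
    have hSo : (x, y - 1) ∈ S → φ (x, y - 1) = φ (x, y) := by
      intro hh
      have := hφ2 x (y - 1) hh (by simpa using h)
      simp only [em2, if_true, sub_add_cancel] at this
      linear_combination -this
    have gE : (if (x + 1, y) ∈ S then
        ((φ (x + 1, y)).val : ℤ) - (φ (x + 1, y) - F (x + 1) y).val else 0) =
        ((φ (x, y) + δ x y).val : ℤ) - (φ (x, y) - F x (y - 1)).val := by
      split_ifs with hh
      · rw [hE hh]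
        congr 3
        simp only [hδ]; ring
      · have := hF0 _ _ hh
        rw [show φ (x, y) + δ x y = φ (x, y) - F x (y - 1) by simp only [hδ, this]; ring]
        simp
    have gN : (if (x, y + 1) ∈ S then
        ((φ (x, y + 1)).val : ℤ) - (φ (x, y + 1) - F x (y + 1)).val else 0) =
        ((φ (x, y) + δ x y).val : ℤ) - (φ (x, y) - F (x - 1) y).val := by
      split_ifs with hh
      · rw [hN hh]
        congr 3
        simp only [hδ]; linear_combination w
      · have := hF0 _ _ hh
        rw [show φ (x, y) + δ x y = φ (x, y) - F (x - 1) y by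
          simp only [hδ]; linear_combination w + this]
        simp
    have gW : (if (x - 1, y) ∈ S then
        ((φ (x - 1, y)).val : ℤ) - (φ (x - 1, y) - F (x - 1) y).val else 0) =
        ((φ (x, y)).val : ℤ) - (φ (x, y) - F (x - 1) y).val := by
      split_ifs with hh
      · rw [hW hh]
      · rw [hF0 _ _ hh]; simp
    have gS : (if (x, y - 1) ∈ S then
        ((φ (x, y - 1)).val : ℤ) - (φ (x, y - 1) - F x (y - 1)).val else 0) =
        ((φ (x, y)).val : ℤ) - (φ (x, y) - F x (y - 1)).val := by
      split_ifs with hh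
      · rw [hSo hh]
      · rw [hF0 _ _ hh]; simp
    simp only
    rw [gE, gN, gW, gS]
    ring
  · intro x y hne
    have hmem : (x, y) ∈ S := by
      by_contra hh
      exact hne (hF0 _ _ hh)
    simp only [hmem, if_true]
    intro h
    apply hne
    have h2 : (φ (x, y)).val = (φ (x, y) - F x y).val := by omega
    have h3 := ZMod.val_injective p h2
    linear_combination h3

/-- A signed finite set of total sign at most one in absolute value has a quasi-perfect
sign-reversing matching. -/
lemma exists_matching {α : Type*} [DecidableEq α] (s : α → ℤˣ) (k : ℕ) :
    ∀ X : Finset α, X.card = k → |∑ a ∈ X, ((s a : ℤˣ) : ℤ)| ≤ 1 →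
    ∃ Y : Finset α, Y ⊆ X ∧ (∀ a ∈ X, ∀ b ∈ X, a ∉ Y → b ∉ Y → a = b) ∧
      ∃ ρ : α → α, (∀ a ∈ Y, ρ a ∈ Y) ∧ (∀ a ∈ Y, ρ (ρ a) = a) ∧ (∀ a ∈ Y, s (ρ a) = - s a) := by
  induction k using Nat.strong_induction_on with
  | _ k ih =>
  intro X hX hsum
  by_cases hmix : ∃ a ∈ X, ∃ b ∈ X, s a = 1 ∧ s b = -1
  · obtain ⟨a, ha, b, hb, sa, sb⟩ := hmix
    have hab : a ≠ b := by
      rintro rfl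
      rw [sa] at sb
      exact absurd sb (by decide)
    have hb' : b ∈ X.erase a := Finset.mem_erase.2 ⟨hab.symm, hb⟩
    have hcard : ((X.erase a).erase b).card < k := by
      rw [← hX]
      exact lt_of_lt_of_le (Finset.card_erase_lt_of_mem hb') (Finset.card_erase_le)
    obtain ⟨Y, hYX, hYs, ρ, h1, h2, h3⟩ := ih _ hcard ((X.erase a).erase b) rfl (by
      have e1 := Finset.add_sum_erase X (fun a => ((s a : ℤˣ) : ℤ)) ha
      have e2 := Finset.add_sum_erase (X.erase a) (fun a => ((s a : ℤˣ) : ℤ)) hb'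
      simp only [sa, sb] at e1 e2
      rw [← e1, ← e2] at hsum
      simpa using hsum)
    have haY : a ∉ Y := fun h => by have := hYX h; simp at this
    have hbY : b ∉ Y := fun h => by have := hYX h; simp at this
    refine ⟨insert a (insert b Y), ?_, ?_, fun c => if c = a then b else if c = b then a else ρ c,
      ?_, ?_, ?_⟩
    · intro c hc
      simp only [Finset.mem_insert] at hc
      rcases hc with rfl | rfl | hc
      · exact ha
      · exact hb
      · exact Finset.mem_of_mem_erase (Finset.mem_of_mem_erase (hYX hc))
    · intro c hc d hd hcY hdY
      simp only [Finset.mem_insert, not_or] at hcY hdY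
      exact hYs c (by simp [hcY, hc]) d (by simp [hdY, hd]) hcY.2.2 hdY.2.2
    · intro c hc
      simp only [Finset.mem_insert] at hc ⊢
      split_ifs with e1 e2
      · simp
      · simp
      · have : c ∈ Y := by tauto
        exact Or.inr (Or.inr (h1 c this))
    · intro c hc
      simp only [Finset.mem_insert] at hc
      by_cases e1 : c = a
      · simp [e1, hab.symm]
      by_cases e2 : c = b
      · simp [e2, hab.symm]
      have hc' : c ∈ Y := by tauto
      have n1 : ρ c ≠ a := fun h => haY (h ▸ h1 c hc')
      have n2 : ρ c ≠ b := fun h => hbY (h ▸ h1 c hc')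
      simp [e1, e2, n1, n2, h2 c hc']
    · intro c hc
      simp only [Finset.mem_insert] at hc
      by_cases e1 : c = a
      · simp [e1, sa, sb]
      by_cases e2 : c = b
      · simp [e2, hab.symm, sa, sb]
      have hc' : c ∈ Y := by tauto
      simp [e1, e2, h3 c hc']
  · have hcard : X.card ≤ 1 := by
      have hall : (∀ a ∈ X, s a = 1) ∨ (∀ a ∈ X, s a = -1) := by
        by_contra hcon
        push Not at hcon
        obtain ⟨⟨b, hb, hb1⟩, a, ha, ha1⟩ := hcon
        exact hmix ⟨a, ha, b, hb, (Int.units_eq_one_or _).resolve_right ha1,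
          (Int.units_eq_one_or _).resolve_left hb1⟩
      rcases hall with h | h
      · rw [Finset.sum_congr rfl fun a ha => by rw [h a ha]] at hsum
        simp at hsum
        omega
      · rw [Finset.sum_congr rfl fun a ha => by rw [h a ha]] at hsum
        simp at hsum
        omega
    refine ⟨∅, by simp, ?_, id, by simp, by simp, by simp⟩
    intro a ha b hb _ _
    exact Finset.card_le_one.1 hcard a ha b hb

lemma adjacent_iff (p : Cell) (x y : ℤ) : Adjacent p (x, y) ↔
    p = (x + 1, y) ∨ p = (x - 1, y) ∨ p = (x, y + 1) ∨ p = (x, y - 1) := by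
  obtain ⟨a, b⟩ := p
  simp only [Adjacent, Prod.mk_sub_mk, Prod.mk.injEq]
  omega

lemma Adjacent.symm' {p q : Cell} (h : Adjacent p q) : Adjacent q p := by
  obtain ⟨a, b⟩ := p
  obtain ⟨x, y⟩ := q
  simp only [Adjacent, Prod.mk_sub_mk, Prod.mk.injEq] at h ⊢
  omega

lemma Adjacent.color {p q : Cell} (h : Adjacent p q) : IsBlackCell p ↔ ¬ IsBlackCell q := by
  obtain ⟨x, y⟩ := q
  obtain ⟨a, b⟩ := p
  rw [adjacent_iff] at h
  simp only [IsBlackCell, Int.even_iff, Prod.mk.injEq] at h ⊢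
  omega

/-- The row equations of the black-to-white matrix in terms of the grid. -/
lemma vecMul_btw {S : Finset Cell} {n : ℕ} (β : Fin n ≃ blackCells S) (ω : Fin n ≃ whiteCells S)
    {K : Type*} [CommRing K] (F : Cell → K) (hF : ∀ c, c ∉ blackCells S → F c = 0) (j : Fin n)
    (x y : ℤ) (hj : (ω j : Cell) = (x, y)) :
    Matrix.vecMul (fun i => F (β i)) ((btwMatrix β ω).map (Int.castRingHom K)) j =
      F (x + 1, y) + F (x - 1, y) + F (x, y + 1) + F (x, y - 1) := by
  have h1 : Matrix.vecMul (fun i => F (β i)) ((btwMatrix β ω).map (Int.castRingHom K)) j =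
      ∑ i, if Adjacent (β i : Cell) (x, y) then F (β i) else 0 := by
    simp only [Matrix.vecMul, dotProduct, Matrix.map_apply, btwMatrix, hj]
    refine Finset.sum_congr rfl fun i _ => ?_
    split_ifs <;> simp
  have h2 : (∑ i, if Adjacent (β i : Cell) (x, y) then F (β i) else 0) =
      ∑ b ∈ blackCells S, if Adjacent b (x, y) then F b else 0 := by
    rw [← Finset.sum_coe_sort (blackCells S)]
    exact Equiv.sum_comp β (fun b : blackCells S => if Adjacent (b : Cell) (x, y) then F b else 0)
  have h3 : (∑ b ∈ blackCells S, if Adjacent b (x, y) then F b else 0) =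
      ∑ b ∈ ({(x + 1, y), (x - 1, y), (x, y + 1), (x, y - 1)} : Finset Cell), F b := by
    rw [← Finset.sum_filter]
    apply Finset.sum_subset
    · intro b hb
      have := (Finset.mem_filter.1 hb).2
      rw [adjacent_iff] at this
      simpa using this
    · intro b hb hb2
      apply hF
      intro hbl
      apply hb2
      rw [Finset.mem_filter, adjacent_iff]
      exact ⟨hbl, by simpa using hb⟩
  rw [h1, h2, h3]
  have n1 : x + 1 ≠ x - 1 := by omega
  have n2 : y + 1 ≠ y - 1 := by omega
  have n3 : x + 1 ≠ x := by omega
  have n4 : x - 1 ≠ x := by omega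
  rw [Finset.sum_insert, Finset.sum_insert, Finset.sum_insert, Finset.sum_singleton]
  · ring
  · simp only [Finset.mem_singleton, Prod.mk.injEq]; omega
  · simp only [Finset.mem_insert, Finset.mem_singleton, Prod.mk.injEq]; omega
  · simp only [Finset.mem_insert, Finset.mem_singleton, Prod.mk.injEq]; omega

/-- Alternating sign attached to the first coordinate. -/
def altSign (x : ℤ) : ℤ := if Even x then 1 else -1

lemma altSign_add (x : ℤ) : altSign (x + 1) = - altSign x := by
  simp only [altSign, Int.even_add_one]
  split_ifs <;> simp_all

lemma altSign_sub (x : ℤ) : altSign (x - 1) = - altSign x := by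
  simp only [altSign, Int.even_sub_one]
  split_ifs <;> simp_all

lemma altSign_sq (x : ℤ) : altSign x * altSign x = 1 := by
  simp only [altSign]
  split_ifs <;> simp

/-- A prime dividing the determinant forces the determinant to vanish. -/
lemma det_eq_zero_of_prime_dvd {S : Finset Cell} (hS : IsBoard S) {n : ℕ}
    (β : Fin n ≃ blackCells S) (ω : Fin n ≃ whiteCells S) (p : ℕ) (hp : p.Prime)
    (hdvd : (p : ℤ) ∣ (btwMatrix β ω).det) : (btwMatrix β ω).det = 0 := by
  classical
  have : Fact p.Prime := ⟨hp⟩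
  have hdet : ((btwMatrix β ω).map (Int.castRingHom (ZMod p))).det = 0 := by
    have h := RingHom.map_det (Int.castRingHom (ZMod p)) (btwMatrix β ω)
    rw [RingHom.mapMatrix_apply] at h
    rw [← h]
    exact (ZMod.intCast_zmod_eq_zero_iff_dvd _ p).2 hdvd
  obtain ⟨f, hf0, hf⟩ := Matrix.exists_vecMul_eq_zero_iff.2 hdet
  set F : Cell → ZMod p := fun c => if h : c ∈ blackCells S then f (β.symm ⟨c, h⟩) else 0 with hFdef
  have hFβ : (fun i => F (β i)) = f := by
    funext i
    simp [hFdef]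
  have hF0 : ∀ c, c ∉ blackCells S → F c = 0 := fun c hc => by simp [hFdef, hc]
  have hblack : ∀ {c : Cell}, c ∈ blackCells S → c ∈ S := fun h => (Finset.mem_filter.1 h).1
  have hwhite : ∀ x y, (x, y) ∈ S → ¬ Even (x + y) → ∃ j, (ω j : Cell) = (x, y) := by
    intro x y h1 h2
    have : (x, y) ∈ whiteCells S := Finset.mem_filter.2 ⟨h1, h2⟩
    exact ⟨ω.symm ⟨_, this⟩, by simp⟩
  obtain ⟨G, hG0, hG, hGF⟩ := lift_wave hS p (fun x y => (altSign x : ZMod p) * F (x, y))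
    (by
      intro x y h
      rw [hF0 _ (fun h' => h (hblack h'))]
      simp)
    (by
      intro x y h ho
      obtain ⟨j, hj⟩ := hwhite x y h ho
      have := vecMul_btw β ω F hF0 j x y hj
      rw [hFβ, hf] at this
      simp only [altSign_add, altSign_sub, Pi.zero_apply] at this ⊢
      push_cast
      linear_combination (altSign x : ZMod p) * this)
  set G' : Cell → ℤ := fun c => if IsBlackCell c then altSign c.1 * G c.1 c.2 else 0 with hG'
  have hG'0 : ∀ c, c ∉ blackCells S → G' c = 0 := by
    intro c hc
    by_cases hb : IsBlackCell c
    · have : (c.1, c.2) ∉ S := fun h => hc (Finset.mem_filter.2 ⟨h, hb⟩)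
      simp [hG', hG0 _ _ this]
    · simp [hG', hb]
  rw [← Matrix.exists_vecMul_eq_zero_iff]
  refine ⟨fun i => G' (β i), ?_, ?_⟩
  · intro hz
    apply hf0
    funext i
    by_contra hi
    have hb : IsBlackCell (β i : Cell) := (Finset.mem_filter.1 (β i).2).2
    have hz' := congrFun hz i
    simp only [hG', hb, if_true, Pi.zero_apply] at hz'
    have hne := hGF (β i : Cell).1 (β i : Cell).2 (by
      intro h
      apply hi
      have h2 : F (β i : Cell) = f i := congrFun hFβ i
      have h3 : ((altSign (β i : Cell).1 * altSign (β i : Cell).1 : ℤ) : ZMod p) = 1 := by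
        rw [altSign_sq]; simp
      push_cast at h3
      have h4 : (altSign (β i : Cell).1 : ZMod p) * F (β i : Cell) = 0 := h
      rw [h2] at h4
      simp only [Pi.zero_apply]
      linear_combination (altSign (β i : Cell).1 : ZMod p) * h4 - f i * h3)
    rcases mul_eq_zero.1 hz' with h | h
    · have := altSign_sq (β i : Cell).1
      rw [h] at this
      simp at this
    · exact hne h
  · funext j
    obtain ⟨⟨x, y⟩, hxy⟩ : ∃ c : Cell, (ω j : Cell) = c := ⟨_, rfl⟩
    have hw := Finset.mem_filter.1 (ω j).2
    rw [hxy] at hw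
    have ho : ¬ Even (x + y) := hw.2
    have h1 := vecMul_btw β ω G' hG'0 j x y hxy
    have hmap : (btwMatrix β ω).map (Int.castRingHom ℤ) = btwMatrix β ω := by
      ext a b; simp
    rw [hmap] at h1
    rw [h1]
    have hw2 := hG x y hw.1 ho
    have c1 : IsBlackCell (x + 1, y) := by
      simp only [IsBlackCell, Int.even_iff] at *; omega
    have c2 : IsBlackCell (x - 1, y) := by
      simp only [IsBlackCell, Int.even_iff] at *; omega
    have c3 : IsBlackCell (x, y + 1) := by
      simp only [IsBlackCell, Int.even_iff] at *; omega
    have c4 : IsBlackCell (x, y - 1) := by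
      simp only [IsBlackCell, Int.even_iff] at *; omega
    simp only [hG', c1, c2, c3, c4, if_true, altSign_add, altSign_sub, Pi.zero_apply]
    linear_combination (-altSign x) * hw2

lemma abs_det_le_one {S : Finset Cell} (hS : IsBoard S) {n : ℕ}
    (β : Fin n ≃ blackCells S) (ω : Fin n ≃ whiteCells S) : |(btwMatrix β ω).det| ≤ 1 := by
  by_cases h : (btwMatrix β ω).det.natAbs = 1
  · rw [Int.abs_eq_natAbs, h]; simp
  · obtain ⟨p, hp, hd⟩ := Nat.exists_prime_and_dvd h
    have := det_eq_zero_of_prime_dvd hS β ω p hp (Int.natCast_dvd.2 hd)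
    rw [this]; simp

/-- The tiling attached to a permutation. -/
def tileOf {S : Finset Cell} {n : ℕ} (β : Fin n ≃ blackCells S) (ω : Fin n ≃ whiteCells S)
    (π : Equiv.Perm (Fin n)) : Finset (Finset Cell) :=
  Finset.univ.image fun j => {(β (π j) : Cell), (ω j : Cell)}

section Tilings

variable {S : Finset Cell} {n : ℕ} (β : Fin n ≃ blackCells S) (ω : Fin n ≃ whiteCells S)

lemma beta_ne_omega (i j : Fin n) : (β i : Cell) ≠ (ω j : Cell) := by
  intro h
  have h1 := (Finset.mem_filter.1 (β i).2).2
  have h2 := (Finset.mem_filter.1 (ω j).2).2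
  rw [h] at h1
  exact h2 h1

lemma pair_inj {i i' j j' : Fin n}
    (h : ({(β i : Cell), (ω j : Cell)} : Finset Cell) = {(β i' : Cell), (ω j' : Cell)}) :
    i = i' ∧ j = j' := by
  have h1 : (β i : Cell) ∈ ({(β i' : Cell), (ω j' : Cell)} : Finset Cell) := by rw [← h]; simp
  have h2 : (ω j : Cell) ∈ ({(β i' : Cell), (ω j' : Cell)} : Finset Cell) := by rw [← h]; simp
  simp only [Finset.mem_insert, Finset.mem_singleton, beta_ne_omega, (beta_ne_omega β ω _ _).symm,
    or_false, false_or] at h1 h2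
  exact ⟨β.injective (Subtype.ext h1), ω.injective (Subtype.ext h2)⟩

lemma permRepresents_tileOf (π : Equiv.Perm (Fin n)) : PermRepresents β ω (tileOf β ω π) π := by
  intro i j
  simp only [tileOf, Finset.mem_image, Finset.mem_univ, true_and]
  constructor
  · rintro rfl
    exact ⟨j, rfl⟩
  · rintro ⟨k, hk⟩
    obtain ⟨h1, h2⟩ := pair_inj β ω hk
    rw [← h2, h1]

lemma permRepresents_unique {τ : Finset (Finset Cell)} {π π' : Equiv.Perm (Fin n)}
    (h : PermRepresents β ω τ π) (h' : PermRepresents β ω τ π') : π = π' := by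
  ext j
  rw [(h' (π j) j).2 ((h _ j).1 rfl)]

lemma exists_beta {c : Cell} (h : c ∈ S) (hb : IsBlackCell c) : ∃ i, (β i : Cell) = c :=
  ⟨β.symm ⟨c, Finset.mem_filter.2 ⟨h, hb⟩⟩, by simp⟩

lemma beta_mem (i : Fin n) : (β i : Cell) ∈ S := (Finset.mem_filter.1 (β i).2).1

lemma omega_mem (j : Fin n) : (ω j : Cell) ∈ S := (Finset.mem_filter.1 (ω j).2).1

lemma exists_omega {c : Cell} (h : c ∈ S) (hb : ¬ IsBlackCell c) : ∃ i, (ω i : Cell) = c :=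
  ⟨ω.symm ⟨c, Finset.mem_filter.2 ⟨h, hb⟩⟩, by simp⟩

lemma domino_form {τ : Finset (Finset Cell)} (hτ : IsTiling S τ) {d : Finset Cell} (hd : d ∈ τ) :
    ∃ i j, d = {(β i : Cell), (ω j : Cell)} ∧ Adjacent (β i : Cell) (ω j : Cell) := by
  obtain ⟨p, q, hpq, rfl⟩ := hτ.1 d hd
  have hsub := hτ.2.1 _ hd
  have hp : p ∈ S := hsub (by simp)
  have hq : q ∈ S := hsub (by simp)
  by_cases hb : IsBlackCell p
  · obtain ⟨i, hi⟩ := exists_beta β hp hb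
    obtain ⟨j, hj⟩ := exists_omega ω hq (hpq.color.1 hb)
    exact ⟨i, j, by rw [hi, hj], by rw [hi, hj]; exact hpq⟩
  · obtain ⟨j, hj⟩ := exists_omega ω hp hb
    obtain ⟨i, hi⟩ := exists_beta β hq (hpq.symm'.color.2 hb)
    exact ⟨i, j, by rw [hi, hj, Finset.pair_comm], by rw [hi, hj]; exact hpq.symm'⟩

lemma exists_perm {τ : Finset (Finset Cell)} (hτ : IsTiling S τ) :
    ∃ π : Equiv.Perm (Fin n), (∀ j, Adjacent (β (π j) : Cell) (ω j : Cell)) ∧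
      τ = tileOf β ω π := by
  have h : ∀ j, ∃ i, ({(β i : Cell), (ω j : Cell)} : Finset Cell) ∈ τ ∧
      Adjacent (β i : Cell) (ω j : Cell) := by
    intro j
    obtain ⟨d, ⟨hd, hj⟩, -⟩ := hτ.2.2 (ω j) (omega_mem ω j)
    obtain ⟨i, j', rfl, hadj⟩ := domino_form β ω hτ hd
    have : j = j' := by
      simp only [Finset.mem_insert, Finset.mem_singleton, (beta_ne_omega β ω _ _).symm,
        false_or] at hj
      exact ω.injective (Subtype.ext hj)
    subst this
    exact ⟨i, hd, hadj⟩
  choose g hg hadj using h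
  have hinj : Function.Injective g := by
    intro j j' hjj
    have h1 := hg j
    have h2 := hg j'
    rw [← hjj] at h2
    have := (hτ.2.2 (β (g j)) (beta_mem β _)).unique ⟨h1, by simp⟩ ⟨h2, by simp⟩
    exact (pair_inj β ω this).2
  refine ⟨Equiv.ofBijective g (Finite.injective_iff_bijective.1 hinj), hadj, ?_⟩
  ext d
  simp only [tileOf, Finset.mem_image, Finset.mem_univ, true_and, Equiv.ofBijective_apply]
  constructor
  · intro hd
    obtain ⟨i, j, rfl, -⟩ := domino_form β ω hτ hd
    refine ⟨j, ?_⟩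
    exact (hτ.2.2 (ω j) (omega_mem ω _)).unique ⟨hg j, by simp⟩ ⟨hd, by simp⟩
  · rintro ⟨j, rfl⟩
    exact hg j

lemma isTiling_tileOf {π : Equiv.Perm (Fin n)}
    (hπ : ∀ j, Adjacent (β (π j) : Cell) (ω j : Cell)) : IsTiling S (tileOf β ω π) := by
  refine ⟨?_, ?_, ?_⟩
  · intro d hd
    simp only [tileOf, Finset.mem_image, Finset.mem_univ, true_and] at hd
    obtain ⟨j, rfl⟩ := hd
    exact ⟨_, _, hπ j, rfl⟩
  · intro d hd
    simp only [tileOf, Finset.mem_image, Finset.mem_univ, true_and] at hd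
    obtain ⟨j, rfl⟩ := hd
    intro c hc
    simp only [Finset.mem_insert, Finset.mem_singleton] at hc
    rcases hc with rfl | rfl
    · exact beta_mem β _
    · exact omega_mem ω _
  · intro c hc
    by_cases hb : IsBlackCell c
    · obtain ⟨i, rfl⟩ := exists_beta β hc hb
      refine ⟨{(β i : Cell), (ω (π.symm i) : Cell)}, ⟨?_, by simp⟩, ?_⟩
      · exact (permRepresents_tileOf β ω π _ _).1 (by simp)
      · rintro d ⟨hd, hm⟩
        simp only [tileOf, Finset.mem_image, Finset.mem_univ, true_and] at hd
        obtain ⟨j, rfl⟩ := hd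
        simp only [Finset.mem_insert, Finset.mem_singleton, beta_ne_omega, or_false] at hm
        have : i = π j := β.injective (Subtype.ext hm)
        subst this
        simp
    · obtain ⟨j, rfl⟩ := exists_omega ω hc hb
      refine ⟨{(β (π j) : Cell), (ω j : Cell)}, ⟨?_, by simp⟩, ?_⟩
      · exact (permRepresents_tileOf β ω π _ _).1 rfl
      · rintro d ⟨hd, hm⟩
        simp only [tileOf, Finset.mem_image, Finset.mem_univ, true_and] at hd
        obtain ⟨j', rfl⟩ := hd
        simp only [Finset.mem_insert, Finset.mem_singleton, (beta_ne_omega β ω _ _).symm,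
          false_or] at hm
        have : j = j' := ω.injective (Subtype.ext hm)
        rw [this]

lemma det_btw : (btwMatrix β ω).det =
    ∑ π ∈ Finset.univ.filter (fun π : Equiv.Perm (Fin n) =>
      ∀ j, Adjacent (β (π j) : Cell) (ω j : Cell)), ((Equiv.Perm.sign π : ℤˣ) : ℤ) := by
  rw [Matrix.det_apply', Finset.sum_filter]
  refine Finset.sum_congr rfl fun π _ => ?_
  simp only [btwMatrix]
  split_ifs with h
  · rw [Finset.prod_eq_one fun j _ => by rw [if_pos (h j)]]
    simp
  · push Not at h
    obtain ⟨j, hj⟩ := h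
    rw [Finset.prod_eq_zero (Finset.mem_univ j) (by rw [if_neg hj])]
    simp

end Tilings

/-- **Theorem.** For a board with equally many black and white cells, there is a
quasi-perfect matching on the set of domino tilings: a subset `Tstar` whose
complement has at most one element, together with a parity-reversing involution
of `Tstar`. -/
theorem exists_quasiPerfectMatching_of_tilings
    (S : Finset Cell) (hS : IsBoard S) (n : ℕ)
    (β : Fin n ≃ blackCells S) (ω : Fin n ≃ whiteCells S) :
    ∃ Tstar : Set (Finset (Finset Cell)),
      Tstar ⊆ {τ | IsTiling S τ} ∧
      ({τ | IsTiling S τ} \ Tstar).Subsingleton ∧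
      ∃ ρ : Finset (Finset Cell) → Finset (Finset Cell),
        (∀ τ ∈ Tstar, ρ τ ∈ Tstar) ∧
        (∀ τ ∈ Tstar, ρ (ρ τ) = τ) ∧
        (∀ τ ∈ Tstar, ∀ π π' : Equiv.Perm (Fin n),
          PermRepresents β ω τ π → PermRepresents β ω (ρ τ) π' →
          Equiv.Perm.sign π' = - Equiv.Perm.sign π) := by
  classical
  have hsum := abs_det_le_one hS β ω
  rw [det_btw] at hsum
  obtain ⟨Y, hYX, hYs, ρ, h1, h2, h3⟩ := exists_matching
    (fun π : Equiv.Perm (Fin n) => Equiv.Perm.sign π) _ _ rfl hsum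
  have hinv : ∀ π : Equiv.Perm (Fin n), ∀ h : ∃ π', tileOf β ω π' = tileOf β ω π,
      h.choose = π := by
    intro π h
    apply permRepresents_unique β ω (permRepresents_tileOf β ω _)
    rw [h.choose_spec]
    exact permRepresents_tileOf β ω π
  set back : Finset (Finset Cell) → Equiv.Perm (Fin n) := fun τ =>
    if h : ∃ π', tileOf β ω π' = τ then h.choose else 1 with hback
  have hbt : ∀ π, back (tileOf β ω π) = π := by
    intro π
    have h : ∃ π', tileOf β ω π' = tileOf β ω π := ⟨π, rfl⟩
    simp only [hback, dif_pos h]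
    exact hinv π h
  refine ⟨tileOf β ω '' (Y : Set (Equiv.Perm (Fin n))), ?_, ?_,
    fun τ => tileOf β ω (ρ (back τ)), ?_, ?_, ?_⟩
  · rintro _ ⟨π, hπ, rfl⟩
    exact isTiling_tileOf β ω (Finset.mem_filter.1 (hYX hπ)).2
  · rintro τ ⟨hτ, hτY⟩ τ' ⟨hτ', hτY'⟩
    obtain ⟨π, hπ, rfl⟩ := exists_perm β ω hτ
    obtain ⟨π', hπ', rfl⟩ := exists_perm β ω hτ'
    rw [hYs π (by simpa using hπ) π' (by simpa using hπ') (fun h => hτY ⟨π, h, rfl⟩)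
      (fun h => hτY' ⟨π', h, rfl⟩)]
  · rintro _ ⟨π, hπ, rfl⟩
    simp only [hbt]
    exact ⟨_, h1 π hπ, rfl⟩
  · rintro _ ⟨π, hπ, rfl⟩
    simp only [hbt]
    rw [h2 π hπ]
  · rintro _ ⟨π₀, hπ₀, rfl⟩ π π' hr hr'
    simp only [hbt] at hr'
    rw [permRepresents_unique β ω hr (permRepresents_tileOf β ω π₀),
      permRepresents_unique β ω hr' (permRepresents_tileOf β ω _)]
    exact h3 π₀ hπ₀
end
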